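/- arXiv:2402.13078 — 2 statements merged into one kernel-verified Lean document; each statement's English description precedes it below -/
import Mathlib

section
/- Let Ω ⊆ ℝ^N be open and let A ⊆ Ω be a measurable set with locally finite perimeter in Ω. Then for every ε > 0 there exists an open set U ⊆ Ω with locally finite perimeter in Ω such that U ⊇ A^{(1)} and λ^N(U \ A) ≤ ε. Here A^{(1)} denotes the set of points x ∈ Ω where A has density 1, i.e. λ^N(A∩B_ρ(x))/λ^N(B_ρ(x)) → 1 as ρ → 0⁺. -/
open MeasureTheory Metric Filter Set
open scoped ENNReal Topology symmDiff

noncomputable section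

abbrev Euc (N : ℕ) : Type := EuclideanSpace ℝ (Fin N)

variable {N : ℕ}

/-- The divergence of a vector field `φ : ℝ^N → ℝ^N`. -/
def diverg (φ : Euc N → Euc N) (x : Euc N) : ℝ :=
  ∑ i : Fin N, fderiv ℝ φ x (EuclideanSpace.single i 1) i

/-- The admissible test vector fields for the variation in `Ω`:
`C^1`, compactly supported in `Ω`, with `‖φ‖ ≤ 1`. -/
def TestVF (Ω : Set (Euc N)) : Set (Euc N → Euc N) :=
  {φ | ContDiff ℝ 1 φ ∧ HasCompactSupport φ ∧ tsupport φ ⊆ Ω ∧ ∀ x, ‖φ x‖ ≤ 1}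

/-- The total variation `V(u, Ω)`. -/
def variation (u : Euc N → ℝ) (Ω : Set (Euc N)) : ℝ≥0∞ :=
  ⨆ φ ∈ TestVF Ω, ENNReal.ofReal (∫ x in Ω, u x * diverg φ x)

/-- The perimeter `P(A, Ω)` of `A` in `Ω`. -/
def perimeter (A Ω : Set (Euc N)) : ℝ≥0∞ :=
  ⨆ φ ∈ TestVF Ω, ENNReal.ofReal (∫ x in A, diverg φ x)

/-- `u ∈ BV(Ω)`. -/
def MemBV (u : Euc N → ℝ) (Ω : Set (Euc N)) : Prop :=
  IntegrableOn u Ω volume ∧ variation u Ω < ⊤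

/-- `u ∈ BV_loc(Ω)`. -/
def MemBVloc (u : Euc N → ℝ) (Ω : Set (Euc N)) : Prop :=
  ∀ Ω' : Set (Euc N), IsOpen Ω' → IsCompact (closure Ω') → closure Ω' ⊆ Ω → MemBV u Ω'

/-- `u ∈ GBV(Ω)`: measurable, and every truncation `(-m) ∨ u ∧ m` is in `BV_loc(Ω)`. -/
def MemGBV (u : Euc N → ℝ) (Ω : Set (Euc N)) : Prop :=
  AEMeasurable u (volume.restrict Ω) ∧
    ∀ m : ℝ, 0 < m → MemBVloc (fun x => max (-m) (min (u x) m)) Ω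

/-- `A` has locally finite perimeter in `Ω`. -/
def HasLocFinPerimeter (A Ω : Set (Euc N)) : Prop :=
  ∀ Ω' : Set (Euc N), IsOpen Ω' → IsCompact (closure Ω') → closure Ω' ⊆ Ω →
    perimeter A Ω' < ⊤

/-- `A` has density `t` at `x`. -/
def HasDensity (A : Set (Euc N)) (x : Euc N) (t : ℝ) : Prop :=
  Tendsto (fun ρ : ℝ => volume (A ∩ ball x ρ) / volume (ball x ρ)) (𝓝[>] 0)
    (𝓝 (ENNReal.ofReal t))

/-- The approximate upper limit `u⁺(x)` of `u` at `x` (relative to `Ω`), with `inf ∅ = ⊤`. -/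
def approxUpper (u : Euc N → ℝ) (Ω : Set (Euc N)) (x : Euc N) : EReal :=
  sInf {t : EReal | ∃ s : ℝ, t = (s : EReal) ∧ HasDensity {y | y ∈ Ω ∧ s < u y} x 0}

/-- The approximate lower limit `u⁻(x)` of `u` at `x` (relative to `Ω`), with `sup ∅ = ⊥`. -/
def approxLower (u : Euc N → ℝ) (Ω : Set (Euc N)) (x : Euc N) : EReal :=
  sSup {t : EReal | ∃ s : ℝ, t = (s : EReal) ∧ HasDensity {y | y ∈ Ω ∧ u y < s} x 0}

/-- The approximate limit `ũ(x)` exists (i.e. `u⁺(x) = u⁻(x)`) and is `+∞`. -/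
def HasApproxLimitTop (u : Euc N → ℝ) (Ω : Set (Euc N)) (x : Euc N) : Prop :=
  approxUpper u Ω x = ⊤ ∧ approxLower u Ω x = ⊤

/-- The approximate limit `ũ(x)` exists and `|ũ(x)| = +∞`. -/
def HasInfApproxLimit (u : Euc N → ℝ) (Ω : Set (Euc N)) (x : Euc N) : Prop :=
  (approxUpper u Ω x = ⊤ ∧ approxLower u Ω x = ⊤) ∨
    (approxUpper u Ω x = ⊥ ∧ approxLower u Ω x = ⊥)

/-- `C` is `L⁰`-polar in `Ω`. -/
def L0Polar (C Ω : Set (Euc N)) : Prop :=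
  ∃ u : Euc N → ℝ, AEMeasurable u (volume.restrict Ω) ∧
    C ⊆ {x | x ∈ Ω ∧ HasInfApproxLimit u Ω x}

/-- `C` is `BV`-polar in `Ω`. -/
def BVPolar (C Ω : Set (Euc N)) : Prop :=
  ∃ u : Euc N → ℝ, MemBV u Ω ∧ C ⊆ {x | x ∈ Ω ∧ HasInfApproxLimit u Ω x}

/-- `C` is `GBV`-polar in `Ω`. -/
def GBVPolar (C Ω : Set (Euc N)) : Prop :=
  ∃ u : Euc N → ℝ, MemGBV u Ω ∧ C ⊆ {x | x ∈ Ω ∧ HasInfApproxLimit u Ω x}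

/-- The set `A^{(1)}` of points of `Ω` where `A` has density `1`. -/
def densityOne (A Ω : Set (Euc N)) : Set (Euc N) :=
  {x | x ∈ Ω ∧ HasDensity A x 1}


lemma diverg_continuous {φ : Euc N → Euc N} (h : ContDiff ℝ 1 φ) : Continuous (diverg φ) := by
  unfold diverg
  refine continuous_finsetSum _ fun i _ => ?_
  have h1 : Continuous fun x => fderiv ℝ φ x (EuclideanSpace.single i 1) :=
    (h.continuous_fderiv (by norm_num)).clm_apply continuous_const
  exact (EuclideanSpace.proj (𝕜 := ℝ) i).continuous.comp h1

lemma diverg_eq_zero {φ : Euc N → Euc N} {x : Euc N} (h : x ∉ tsupport φ) : diverg φ x = 0 := by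
  have : fderiv ℝ φ x = 0 := by
    by_contra hx
    exact h (tsupport_fderiv_subset ℝ (subset_tsupport _ hx))
  simp [diverg, this]

lemma diverg_hasCompactSupport {φ : Euc N → Euc N} (h : HasCompactSupport φ) :
    HasCompactSupport (diverg φ) :=
  HasCompactSupport.intro h fun _ hx => diverg_eq_zero hx

lemma diverg_integrable {φ : Euc N → Euc N} (h : ContDiff ℝ 1 φ) (hc : HasCompactSupport φ) :
    Integrable (diverg φ) :=
  (diverg_continuous h).integrable_of_hasCompactSupport (diverg_hasCompactSupport hc)

lemma le_perimeter {A W : Set (Euc N)} {φ : Euc N → Euc N} (h : φ ∈ TestVF W) :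
    ENNReal.ofReal (∫ x in A, diverg φ x) ≤ perimeter A W :=
  le_iSup₂ (f := fun φ (_ : φ ∈ TestVF W) => ENNReal.ofReal (∫ x in A, diverg φ x)) φ h

lemma testVF_mono {W W' : Set (Euc N)} (h : W ⊆ W') : TestVF W ⊆ TestVF W' :=
  fun _ hφ => ⟨hφ.1, hφ.2.1, hφ.2.2.1.trans h, hφ.2.2.2⟩

lemma perimeter_mono {A W W' : Set (Euc N)} (h : W ⊆ W') : perimeter A W ≤ perimeter A W' :=
  iSup₂_le fun _ hφ => le_perimeter (testVF_mono h hφ)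

lemma perimeter_congr {A B W : Set (Euc N)} (h : A =ᵐ[volume] B) :
    perimeter A W = perimeter B W := by
  unfold perimeter
  simp_rw [setIntegral_congr_set h]

lemma zero_mem_testVF (W : Set (Euc N)) : (fun _ => 0 : Euc N → Euc N) ∈ TestVF W := by
  refine ⟨contDiff_const, HasCompactSupport.zero, ?_, by simp⟩
  have : tsupport (fun _ => 0 : Euc N → Euc N) = ∅ := by
    rw [tsupport_eq_empty_iff]; rfl
  rw [this]; exact empty_subset _

lemma diverg_add {φ ψ : Euc N → Euc N} (h : ContDiff ℝ 1 φ) (h' : ContDiff ℝ 1 ψ) (x : Euc N) :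
    diverg (fun x => φ x + ψ x) x = diverg φ x + diverg ψ x := by
  unfold diverg
  rw [← Finset.sum_add_distrib]
  refine Finset.sum_congr rfl fun i _ => ?_
  rw [fderiv_fun_add (h.differentiable (by norm_num) x) (h'.differentiable (by norm_num) x)]
  simp

lemma perimeter_add_le {A W W' : Set (Euc N)} (hd : Disjoint W W') :
    perimeter A W + perimeter A W' ≤ perimeter A (W ∪ W') := by
  unfold perimeter
  refine ENNReal.biSup_add_biSup_le' ⟨_, zero_mem_testVF W⟩ ⟨_, zero_mem_testVF W'⟩ ?_
  intro φ hφ ψ hψ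
  have hmem : (fun x => φ x + ψ x) ∈ TestVF (W ∪ W') := by
    refine ⟨hφ.1.add hψ.1, hφ.2.1.add hψ.2.1, ?_, ?_⟩
    · exact (tsupport_add φ ψ).trans (union_subset_union hφ.2.2.1 hψ.2.2.1)
    · intro x
      by_cases hx : x ∈ W
      · have : ψ x = 0 := by
          by_contra h
          exact hd.le_bot ⟨hx, hψ.2.2.1 (subset_tsupport _ h)⟩
        simpa [this] using hφ.2.2.2 x
      · have : φ x = 0 := by
          by_contra h
          exact hx (hφ.2.2.1 (subset_tsupport _ h))
        simpa [this] using hψ.2.2.2 x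
  by_cases h1 : 0 ≤ ∫ x in A, diverg φ x
  · by_cases h2 : 0 ≤ ∫ x in A, diverg ψ x
    · rw [← ENNReal.ofReal_add h1 h2, ← integral_add
        (diverg_integrable hφ.1 hφ.2.1).integrableOn (diverg_integrable hψ.1 hψ.2.1).integrableOn]
      simp_rw [← diverg_add hφ.1 hψ.1]
      exact le_perimeter hmem
    · rw [ENNReal.ofReal_of_nonpos (le_of_not_ge h2), add_zero]
      exact le_perimeter (testVF_mono subset_union_left hφ)
  · rw [ENNReal.ofReal_of_nonpos (le_of_not_ge h1), zero_add]
    exact le_perimeter (testVF_mono subset_union_right hψ)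

lemma perimeter_finset_sum_le {ι : Type*} {A : Set (Euc N)} (W : ι → Set (Euc N))
    (s : Finset ι) (hd : (s : Set ι).PairwiseDisjoint W) :
    ∑ i ∈ s, perimeter A (W i) ≤ perimeter A (⋃ i ∈ s, W i) := by
  classical
  induction s using Finset.induction_on with
  | empty => simp
  | insert a s ha ih =>
    rw [Finset.sum_insert ha, Finset.set_biUnion_insert]
    refine le_trans ?_ (perimeter_add_le ?_)
    · gcongr
      exact ih (hd.subset (by simp))
    · rw [disjoint_iUnion₂_right]
      intro i hi
      exact hd (by simp) (by simp [hi]) (fun h => ha (h ▸ hi))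

lemma perimeter_tsum_le {ι : Type*} {A V : Set (Euc N)} (W : ι → Set (Euc N))
    (hd : Pairwise (Function.onFun Disjoint W)) (hV : ∀ i, W i ⊆ V) :
    ∑' i, perimeter A (W i) ≤ perimeter A V := by
  rw [ENNReal.tsum_eq_iSup_sum]
  refine iSup_le fun s => (perimeter_finset_sum_le W s fun i _ j _ hij => hd hij).trans
    (perimeter_mono (iUnion₂_subset fun i _ => hV i))

lemma fderiv_shift {h : Euc N → ℝ} (c x : Euc N) :
    fderiv ℝ (fun y => h (y - c)) x = fderiv ℝ h (x - c) := by
  simpa using fderiv_comp_sub (𝕜 := ℝ) (f := h) (x := x) c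

/-- One inner derivative is bounded by the perimeter. -/
lemma deriv_bound {A W : Set (Euc N)} (hP : perimeter A W ≠ ⊤)
    {h : Euc N → ℝ} (hh : ContDiff ℝ 1 h) (hc : HasCompactSupport h) (hb : ∀ x, |h x| ≤ 1)
    (c v : Euc N) (hW : ∀ x ∈ tsupport h, x + c ∈ W) :
    ∫ x in A, fderiv ℝ h (x - c) v ≤ ‖v‖ * (perimeter A W).toReal := by
  by_cases hv : v = 0
  · simp [hv]
  have hv' : 0 < ‖v‖ := norm_pos_iff.2 hv
  set φ : Euc N → Euc N := fun x => h (x - c) • (‖v‖⁻¹ • v) with hφ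
  have hts : ∀ x, x ∈ tsupport φ → x - c ∈ tsupport h := by
    intro x hx
    have h1 : Function.support φ ⊆ (fun y => y - c) ⁻¹' (tsupport h) := by
      intro y hy
      apply subset_tsupport
      intro h0
      apply hy
      simp [hφ, h0]
    exact closure_minimal h1 ((isClosed_tsupport h).preimage (by fun_prop)) hx
  have hcs : HasCompactSupport φ := by
    have : IsCompact ((Homeomorph.addRight c) '' tsupport h) := hc.isCompact.image (by fun_prop)
    refine HasCompactSupport.intro this fun x hx => ?_
    by_contra h0
    exact hx ⟨x - c, hts x (subset_tsupport _ h0), by simp⟩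
  have hcd : ContDiff ℝ 1 φ := by
    have : ContDiff ℝ 1 fun x => h (x - c) := hh.comp (by fun_prop)
    exact this.smul contDiff_const
  have hmem : φ ∈ TestVF W := by
    refine ⟨hcd, hcs, fun x hx => by simpa using hW _ (hts x hx), fun x => ?_⟩
    rw [hφ]
    simp only [norm_smul, norm_inv, norm_norm, inv_mul_cancel₀ hv'.ne', mul_one]
    exact hb _
  have hdiv : ∀ x, diverg φ x = ‖v‖⁻¹ * fderiv ℝ h (x - c) v := by
    intro x
    have hd : DifferentiableAt ℝ (fun y => h (y - c)) x :=
      (hh.differentiable (by norm_num) _).comp x (by fun_prop)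
    have hf : ∀ u, fderiv ℝ φ x u = fderiv ℝ h (x - c) u • (‖v‖⁻¹ • v) := by
      intro u
      rw [hφ, fderiv_smul_const hd, fderiv_shift]
      simp
    unfold diverg
    simp_rw [hf]
    have hvs : v = ∑ i, v i • EuclideanSpace.single i (1 : ℝ) := by
      ext j
      simp [Finset.sum_apply, Pi.single_apply]
    conv_rhs => rw [hvs, map_sum]
    rw [Finset.mul_sum, ← hvs]
    refine Finset.sum_congr rfl fun i _ => ?_
    simp; ring
  have h1 := le_perimeter (A := A) hmem
  have h2 : ∫ x in A, diverg φ x ≤ (perimeter A W).toReal :=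
    (ENNReal.ofReal_le_iff_le_toReal hP).1 h1
  simp_rw [hdiv] at h2
  rw [integral_const_mul] at h2
  rwa [inv_mul_le_iff₀ hv'] at h2

lemma translate_bound {A W : Set (Euc N)} (hP : perimeter A W ≠ ⊤)
    {h : Euc N → ℝ} (hh : ContDiff ℝ 1 h) (hc : HasCompactSupport h) (hb : ∀ x, |h x| ≤ 1)
    (v : Euc N) (hW : ∀ x ∈ tsupport h, ∀ t ∈ Icc (0:ℝ) 1, x + t • v ∈ W) :
    (∫ x in A, h x) - ∫ x in A, h (x - v) ≤ ‖v‖ * (perimeter A W).toReal := by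
  set F : ℝ → ℝ := fun t => ∫ x in A, h (x - t • v) with hF
  set F' : ℝ → ℝ := fun t => ∫ x in A, -(fderiv ℝ h (x - t • v) v) with hF'
  have hcont : Continuous h := hh.continuous
  have hcf : Continuous (fderiv ℝ h) := hh.continuous_fderiv (by norm_num)
  obtain ⟨R, hR⟩ := hc.isCompact.isBounded.subset_closedBall 0
  obtain ⟨C, hC⟩ := (hc.fderiv (𝕜 := ℝ)).exists_bound_of_continuous hcf
  have hz : ∀ x, x ∉ closedBall (0 : Euc N) R → fderiv ℝ h x = 0 := by
    intro x hx
    by_contra h0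
    exact hx (hR (tsupport_fderiv_subset ℝ (subset_tsupport _ h0)))
  have hder : ∀ t, HasDerivAt F (F' t) t := by
    intro t₀
    refine (hasDerivAt_integral_of_dominated_loc_of_deriv_le (s := ball t₀ 1)
      (F := fun t x => h (x - t • v)) (F' := fun t x => -(fderiv ℝ h (x - t • v) v))
      (bound := (closedBall (0 : Euc N) (R + (|t₀| + 1) * ‖v‖)).indicator fun _ => C * ‖v‖)
      (ball_mem_nhds _ one_pos) ?_ ?_ ?_ ?_ ?_ ?_).2
    · exact Eventually.of_forall fun t => Continuous.aestronglyMeasurable (by fun_prop)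
    · have : HasCompactSupport fun x => h (x - t₀ • v) := by
        have := hc.comp_homeomorph (Homeomorph.addRight (-(t₀ • v)))
        have he : (fun x => h (x - t₀ • v)) = h ∘ (Homeomorph.addRight (-(t₀ • v))) := by
          ext x; simp [sub_eq_add_neg]
        rwa [he]
      exact ((show Continuous fun x => h (x - t₀ • v) by fun_prop).integrable_of_hasCompactSupport
        this).integrableOn
    · exact Continuous.aestronglyMeasurable (by fun_prop)
    · refine Eventually.of_forall fun x t ht => ?_
      by_cases hx : x ∈ closedBall (0 : Euc N) (R + (|t₀| + 1) * ‖v‖)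
      · rw [indicator_of_mem hx, norm_neg]
        exact (ContinuousLinearMap.le_opNorm _ _).trans (by gcongr; exact hC _)
      · rw [indicator_of_notMem hx, hz]
        · simp
        · intro h1
          apply hx
          rw [mem_closedBall_zero_iff] at h1 ⊢
          have h2 : |t| ≤ |t₀| + 1 := by
            have := abs_sub_abs_le_abs_sub t t₀
            rw [mem_ball, Real.dist_eq] at ht
            linarith
          calc ‖x‖ = ‖(x - t • v) + t • v‖ := by simp
            _ ≤ ‖x - t • v‖ + ‖t • v‖ := norm_add_le _ _
            _ ≤ R + (|t₀| + 1) * ‖v‖ := by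
              rw [norm_smul, Real.norm_eq_abs]; gcongr
    · refine Integrable.integrableOn ?_
      rw [integrable_indicator_iff measurableSet_closedBall]
      exact integrableOn_const (isCompact_closedBall _ _).measure_lt_top.ne
    · refine Eventually.of_forall fun x t ht => ?_
      have h1 : HasFDerivAt h (fderiv ℝ h (x - t • v)) (x - t • v) :=
        (hh.differentiable (by norm_num) _).hasFDerivAt
      have h2 : HasDerivAt (fun t : ℝ => x - t • v) (-v) t := by
        simpa using ((hasDerivAt_id t).smul_const v).const_sub x
      simpa [Function.comp_def] using h1.comp_hasDerivAt t h2
  have hmv := Convex.image_sub_le_mul_sub_of_deriv_le (D := Icc (0:ℝ) 1) (convex_Icc 0 1)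
    (f := fun t => - F t) (C := ‖v‖ * (perimeter A W).toReal)
    (fun t _ => (hder t).neg.continuousAt.continuousWithinAt)
    (fun t _ => (hder t).neg.differentiableAt.differentiableWithinAt) ?_ 0 (by simp) 1 (by simp)
    zero_le_one
  · simp only [hF] at hmv
    simp at hmv
    linarith
  · intro t ht
    rw [show (fun t => -F t) = -F from rfl, (hder t).neg.deriv, hF']
    simp only [integral_neg, neg_neg]
    exact deriv_bound hP hh hc hb (t • v) v fun x hx => hW x hx t (interior_subset ht)

lemma measure_shift_le {A W : Set (Euc N)} (hA : MeasurableSet A) (hWo : IsOpen W)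
    (hWc : Convex ℝ W) (hWv : volume W ≠ ⊤) (v : Euc N) :
    volume {x | x ∈ W ∩ A ∧ x + v ∈ W \ A} ≤ ENNReal.ofReal ‖v‖ * perimeter A W := by
  by_cases hv0 : v = 0
  · have : {x | x ∈ W ∩ A ∧ x + v ∈ W \ A} = ∅ := by
      ext x; simp [hv0]
    rw [this]; simp
  by_cases hP : perimeter A W = ⊤
  · rw [hP, ENNReal.mul_top (by simpa using hv0)]; exact le_top
  set B : Set (Euc N) := W ∩ {x | x + v ∈ W} with hB
  have hBo : IsOpen B := hWo.inter (hWo.preimage (by fun_prop))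
  set A' : Set (Euc N) := {x | x + v ∈ A} with hA'
  have hA'm : MeasurableSet A' := hA.preimage (by fun_prop)
  set E : Set (Euc N) := {x | x ∈ W ∩ A ∧ x + v ∈ W \ A} with hE
  have hEeq : E = B ∩ (A \ A') := by
    ext x; simp [hE, hB, hA']; tauto
  have hEm : MeasurableSet E := hEeq ▸ hBo.measurableSet.inter (hA.diff hA'm)
  have hEB : E ⊆ B := hEeq ▸ inter_subset_left
  have hEfin : volume E ≠ ⊤ := measure_ne_top_of_subset (hEB.trans inter_subset_left) hWv
  have key : ∀ δ : ℝ, 0 < δ →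
      (volume E).toReal ≤ ‖v‖ * (perimeter A W).toReal + 3 * δ := by
    intro δ hδ
    have hδ' : ENNReal.ofReal δ ≠ 0 := by simpa using hδ
    obtain ⟨K, hKE, hK, hKm⟩ := hEm.exists_isCompact_lt_add hEfin hδ'
    obtain ⟨O₁, hEO, hO₁, hOm⟩ := E.exists_isOpen_lt_add hEfin hδ'
    set O := O₁ ∩ B
    have hO : IsOpen O := hO₁.inter hBo
    have hKO : K ⊆ O := fun x hx => ⟨hEO (hKE hx), hEB (hKE hx)⟩
    obtain ⟨V, hV, hKV, hVO, hVc⟩ := exists_open_between_and_isCompact_closure hK hO hKO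
    obtain ⟨h, hh, hr, hs, h1⟩ := exists_contMDiff_support_eq_eq_one_iff (n := 1) (modelWithCornersSelf ℝ (Euc N))
      hV hK.isClosed hKV
    have hhc : ContDiff ℝ 1 h := by simpa using hh.contDiff
    have hts : tsupport h = closure V := by rw [tsupport, hs]
    have hcs : HasCompactSupport h := by rw [HasCompactSupport, hts]; exact hVc
    have h01 : ∀ x, 0 ≤ h x ∧ h x ≤ 1 := fun x => hr ⟨x, rfl⟩
    have hT := translate_bound hP hhc hcs (fun x => abs_le.2 ⟨by linarith [h01 x], (h01 x).2⟩) v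
      (by
        intro x hx t ht
        rw [hts] at hx
        have hxB : x ∈ B := (hVO hx).2
        exact hWc.add_smul_mem hxB.1 hxB.2 ht)
    have hintg : Integrable h := hhc.continuous.integrable_of_hasCompactSupport hcs
    have hshift : ∫ x in A, h (x - v) = ∫ x in A', h x := by
      rw [← integral_indicator hA, ← integral_indicator hA'm,
        ← integral_add_right_eq_self _ v]
      congr 1; ext x
      by_cases hx : x + v ∈ A
      · rw [indicator_of_mem hx, indicator_of_mem (show x ∈ A' from hx)]; simp
      · rw [indicator_of_notMem hx, indicator_of_notMem (show x ∉ A' from hx)]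
    rw [hshift] at hT
    have hOfin : volume O ≠ ⊤ := measure_ne_top_of_subset (inter_subset_right.trans inter_subset_left) hWv
    have hKfin : volume K ≠ ⊤ := hK.measure_lt_top.ne
    have low : (volume K).toReal ≤ ∫ x in A, h x := by
      calc (volume K).toReal = ∫ x in K, (1:ℝ) := by simp [Measure.real]
        _ = ∫ x in K, h x := setIntegral_congr_fun hK.measurableSet fun x hx => ((h1 x).1 hx).symm
        _ ≤ ∫ x in A, h x := setIntegral_mono_set hintg.integrableOn
            (Eventually.of_forall fun x => (h01 x).1)
            (Eventually.of_forall fun x hx => (hKE hx).1.2)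
    have up : ∫ x in A', h x ≤ (volume (O \ K)).toReal := by
      have hm : MeasurableSet (O \ K) := hO.measurableSet.diff hK.measurableSet
      calc ∫ x in A', h x = ∫ x, A'.indicator h x := (integral_indicator hA'm).symm
        _ ≤ ∫ x, (O \ K).indicator (fun _ => (1:ℝ)) x := by
          refine integral_mono (hintg.indicator hA'm)
            ((integrable_indicator_iff hm).2 (integrableOn_const
              (measure_ne_top_of_subset sdiff_subset hOfin))) fun x => ?_
          by_cases hx : x ∈ O \ K
          · rw [indicator_of_mem hx]
            by_cases hx' : x ∈ A' <;> simp [hx', (h01 x).2]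
          · rw [indicator_of_notMem hx]
            by_cases hx' : x ∈ A'
            · rw [indicator_of_mem hx']
              have : x ∉ tsupport h := by
                rw [hts]
                intro h2
                exact hx ⟨hVO h2, fun h3 => (hKE h3).2.2 hx'⟩
              rw [image_eq_zero_of_notMem_tsupport this]
            · simp [hx']
        _ = _ := by rw [integral_indicator hm]; simp [Measure.real]
    have m1 : (volume E).toReal ≤ (volume K).toReal + δ := by
      have := ENNReal.toReal_mono (by finiteness) hKm.le
      rwa [ENNReal.toReal_add hKfin (by simp), ENNReal.toReal_ofReal hδ.le] at this
    have m2 : (volume O).toReal ≤ (volume E).toReal + δ := by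
      have := ENNReal.toReal_mono (by finiteness) ((measure_mono inter_subset_left).trans hOm.le : volume O ≤ _)
      rwa [ENNReal.toReal_add hEfin (by simp), ENNReal.toReal_ofReal hδ.le] at this
    have m3 : (volume (O \ K)).toReal = (volume O).toReal - (volume K).toReal := by
      rw [measure_sdiff hKO hK.measurableSet.nullMeasurableSet hKfin,
        ENNReal.toReal_sub_of_le (measure_mono hKO) hOfin]
    linarith
  have key2 : (volume E).toReal ≤ ‖v‖ * (perimeter A W).toReal := by
    refine le_of_forall_pos_le_add fun δ hδ => ?_
    have := key (δ / 3) (by positivity)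
    linarith
  rw [← ENNReal.ofReal_toReal hEfin, ← ENNReal.ofReal_toReal hP, ← ENNReal.ofReal_mul (norm_nonneg _)]
  exact ENNReal.ofReal_le_ofReal key2

lemma poincare {A W : Set (Euc N)} (hA : MeasurableSet A) (hWo : IsOpen W)
    (hWc : Convex ℝ W) (hWv : volume W ≠ ⊤) (d : ℝ)
    (hd : ∀ x ∈ W, ∀ y ∈ W, dist x y ≤ d) :
    volume (W ∩ A) * volume (W \ A) ≤
      volume (closedBall (0 : Euc N) d) * (ENNReal.ofReal d * perimeter A W) := by
  set f : Euc N → ℝ≥0∞ := (W ∩ A).indicator 1 with hf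
  set g : Euc N → ℝ≥0∞ := (W \ A).indicator 1 with hg
  have hm1 : MeasurableSet (W ∩ A) := hWo.measurableSet.inter hA
  have hm2 : MeasurableSet (W \ A) := hWo.measurableSet.diff hA
  have hfm : Measurable f := measurable_one.indicator hm1
  have hgm : Measurable g := measurable_one.indicator hm2
  calc volume (W ∩ A) * volume (W \ A) = ∫⁻ x, f x * ∫⁻ y, g y := by
        rw [lintegral_mul_const _ hfm, lintegral_indicator_one hm1, lintegral_indicator_one hm2]
    _ = ∫⁻ x, ∫⁻ v, f x * g (x + v) := by
        refine lintegral_congr fun x => ?_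
        rw [lintegral_const_mul _ (by fun_prop), lintegral_add_left_eq_self]
    _ = ∫⁻ v, ∫⁻ x, f x * g (x + v) := by
        refine lintegral_lintegral_swap (Measurable.aemeasurable ?_)
        exact (hfm.comp measurable_fst).mul (hgm.comp (measurable_fst.add measurable_snd))
    _ = ∫⁻ v, volume {x | x ∈ W ∩ A ∧ x + v ∈ W \ A} := by
        refine lintegral_congr fun v => ?_
        rw [show {x | x ∈ W ∩ A ∧ x + v ∈ W \ A} = (W ∩ A) ∩ (fun x => x + v) ⁻¹' (W \ A) from rfl,
          ← lintegral_indicator_one (hm1.inter (hm2.preimage (by fun_prop : Measurable fun x => x + v)))]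
        refine lintegral_congr fun x => ?_
        by_cases h1 : x ∈ W ∩ A <;> by_cases h2 : x + v ∈ W \ A
        · rw [hf, hg, indicator_of_mem h1, indicator_of_mem h2, 
            indicator_of_mem (show x ∈ (W ∩ A) ∩ (fun x => x + v) ⁻¹' (W \ A) from ⟨h1, h2⟩)]; simp
        · rw [hg, indicator_of_notMem h2, indicator_of_notMem (fun h => h2 h.2)]; simp
        · rw [hf, indicator_of_notMem h1, indicator_of_notMem (fun h => h1 h.1)]; simp
        · rw [hf, indicator_of_notMem h1, indicator_of_notMem (fun h => h1 h.1)]; simp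
    _ ≤ ∫⁻ v, (closedBall (0 : Euc N) d).indicator (fun _ => ENNReal.ofReal d * perimeter A W) v := by
        refine lintegral_mono fun v => ?_
        by_cases hv : v ∈ closedBall (0 : Euc N) d
        · rw [indicator_of_mem hv]
          refine (measure_shift_le hA hWo hWc hWv v).trans ?_
          gcongr
          simpa using hv
        · rw [indicator_of_notMem hv]
          have : {x | x ∈ W ∩ A ∧ x + v ∈ W \ A} = ∅ := by
            ext x
            simp only [mem_ofPred_eq, mem_empty_iff_false, iff_false]
            rintro ⟨h1, h2⟩
            apply hv
            simpa using hd _ h2.1 _ h1.1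
          rw [this]; simp
    _ = _ := by
        rw [lintegral_indicator measurableSet_closedBall, setLIntegral_const, mul_comm]

/-- Indices of dyadic cubes: level and integer corner. -/
abbrev Cube (N : ℕ) : Type := ℕ × (Fin N → ℤ)

/-- Half-open dyadic cube. -/
def dy (q : Cube N) : Set (Euc N) := {x | ∀ i, ⌊(2:ℝ) ^ q.1 * x i⌋ = q.2 i}

/-- Open dyadic cube. -/
def dyo (q : Cube N) : Set (Euc N) :=
  {x | ∀ i, (2:ℝ) ^ q.1 * x i ∈ Ioo (q.2 i : ℝ) (q.2 i + 1)}

/-- Index of the cube of level `k` containing `x`. -/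
def idx (k : ℕ) (x : Euc N) : Fin N → ℤ := fun i => ⌊(2:ℝ) ^ k * x i⌋

def lo (q : Cube N) : Fin N → ℝ := fun i => q.2 i / 2 ^ q.1
def hi (q : Cube N) : Fin N → ℝ := fun i => (q.2 i + 1) / 2 ^ q.1

lemma mem_dy_idx (k : ℕ) (x : Euc N) : x ∈ dy (k, idx k x) := fun _ => rfl

lemma mem_dy_iff {q : Cube N} {x : Euc N} : x ∈ dy q ↔ idx q.1 x = q.2 :=
  ⟨fun h => funext h, fun h i => congrFun h i⟩

lemma dy_eq (q : Cube N) :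
    dy q = WithLp.ofLp ⁻¹' (univ.pi fun i => Ico (lo q i) (hi q i)) := by
  ext x
  have h2 : (0:ℝ) < 2 ^ q.1 := by positivity
  simp only [dy, mem_ofPred_eq, mem_preimage, Set.mem_pi, mem_univ, true_implies, mem_Ico, lo, hi,
    Int.floor_eq_iff, div_le_iff₀ h2, lt_div_iff₀ h2]
  simp only [mul_comm]

lemma dyo_eq (q : Cube N) :
    dyo q = WithLp.ofLp ⁻¹' (univ.pi fun i => Ioo (lo q i) (hi q i)) := by
  ext x
  have h2 : (0:ℝ) < 2 ^ q.1 := by positivity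
  simp only [dyo, mem_ofPred_eq, mem_preimage, Set.mem_pi, mem_univ, true_implies, mem_Ioo, lo, hi,
    div_lt_iff₀ h2, lt_div_iff₀ h2]
  simp only [mul_comm]

/-- side length -/
def sd (k : ℕ) : ℝ≥0∞ := (2⁻¹ : ℝ≥0∞) ^ k

lemma sd_ne_zero (k : ℕ) : sd k ≠ 0 := by simp [sd]
lemma sd_ne_top (k : ℕ) : sd k ≠ ⊤ := by simp [sd]

lemma sd_eq (k : ℕ) : sd k = ENNReal.ofReal (((2:ℝ) ^ k)⁻¹) := by
  rw [sd, ENNReal.ofReal_inv_of_pos (by positivity), ENNReal.ofReal_pow (by norm_num),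
    ENNReal.inv_pow]
  simp

lemma sd_le {k l : ℕ} (h : k ≤ l) : sd l ≤ sd k :=
  pow_le_pow_right_of_le_one' (by simp) h

lemma sd_succ (k : ℕ) : sd k = 2 * sd (k + 1) := by
  rw [sd, sd, pow_succ, mul_comm, mul_assoc, ENNReal.inv_mul_cancel (by simp) (by simp), mul_one]

lemma hi_sub_lo (q : Cube N) (i : Fin N) : hi q i - lo q i = ((2:ℝ) ^ q.1)⁻¹ := by
  simp only [hi, lo]; field_simp; ring

lemma measurableSet_dy (q : Cube N) : MeasurableSet (dy q) := by
  rw [dy_eq]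
  exact (PiLp.volume_preserving_ofLp (Fin N)).measurable
    (MeasurableSet.univ_pi fun i => measurableSet_Ico)

lemma isOpen_dyo (q : Cube N) : IsOpen (dyo q) := by
  rw [dyo_eq]
  exact (isOpen_set_pi finite_univ fun i _ => isOpen_Ioo).preimage (by fun_prop)

lemma volume_dy (q : Cube N) : volume (dy q) = sd q.1 ^ N := by
  rw [dy_eq, (PiLp.volume_preserving_ofLp (Fin N)).measure_preimage
    (MeasurableSet.univ_pi fun i => measurableSet_Ico).nullMeasurableSet, volume_pi_pi]
  simp [Real.volume_Ico, hi_sub_lo, sd_eq]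

lemma volume_dyo (q : Cube N) : volume (dyo q) = sd q.1 ^ N := by
  rw [dyo_eq, (PiLp.volume_preserving_ofLp (Fin N)).measure_preimage
    (MeasurableSet.univ_pi fun i => measurableSet_Ioo).nullMeasurableSet, volume_pi_pi]
  simp [Real.volume_Ioo, hi_sub_lo, sd_eq]

lemma dyo_subset (q : Cube N) : dyo q ⊆ dy q := by
  rw [dy_eq, dyo_eq]
  exact preimage_mono (pi_mono fun i _ => Ioo_subset_Ico_self)

lemma volume_dy_ne_top (q : Cube N) : volume (dy q) ≠ ⊤ := by
  rw [volume_dy]; exact ENNReal.pow_ne_top (sd_ne_top _)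

lemma dyo_ae_eq (q : Cube N) : dyo q =ᵐ[volume] dy q :=
  ae_eq_of_subset_of_measure_ge (dyo_subset q) (by rw [volume_dy, volume_dyo])
    (isOpen_dyo q).measurableSet.nullMeasurableSet (volume_dy_ne_top q)

lemma convex_dyo (q : Cube N) : Convex ℝ (dyo q) := by
  have : Convex ℝ (univ.pi fun i => Ioo (lo q i) (hi q i)) := convex_pi fun i _ => convex_Ioo _ _
  rw [dyo_eq]
  exact this.linear_preimage (WithLp.linearEquiv 2 ℝ (Fin N → ℝ)).toLinearMap

lemma idx_coarse {k l : ℕ} (h : k ≤ l) (x : Euc N) (i : Fin N) :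
    idx k x i = idx l x i / ((2 ^ (l - k) : ℕ) : ℤ) := by
  rw [idx, idx, ← Int.floor_div_natCast]
  congr 1
  push_cast
  rw [eq_div_iff (by positivity)]
  conv_rhs => rw [← Nat.sub_add_cancel h, pow_add]
  ring

lemma dy_nested {p q : Cube N} {x : Euc N} (h : p.1 ≤ q.1) (hp : x ∈ dy p) (hq : x ∈ dy q) :
    dy q ⊆ dy p := by
  intro y hy
  rw [mem_dy_iff] at *
  rw [← hp]
  ext i
  rw [idx_coarse h, idx_coarse h, hy, hq]

lemma dy_same_level {p q : Cube N} {x : Euc N} (h : p.1 = q.1) (hp : x ∈ dy p) (hq : x ∈ dy q) :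
    p = q := by
  rw [mem_dy_iff] at *
  refine Prod.ext h ?_
  rw [← hp, ← hq, h]

/-- The maximal cubes of a family. -/
def mx (F : Set (Cube N)) : Set (Cube N) :=
  {q | q ∈ F ∧ ∀ p ∈ F, p.1 < q.1 → Disjoint (dy p) (dy q)}

lemma mx_subset (F : Set (Cube N)) : mx F ⊆ F := fun _ h => h.1

lemma exists_mx {F : Set (Cube N)} {q : Cube N} {x : Euc N} (hq : q ∈ F) (hx : x ∈ dy q) :
    ∃ p ∈ mx F, x ∈ dy p := by
  classical
  have hex : ∃ k, ∃ p ∈ F, p.1 = k ∧ x ∈ dy p := ⟨q.1, q, hq, rfl, hx⟩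
  obtain ⟨p, hp, hpk, hxp⟩ := Nat.find_spec hex
  refine ⟨p, ⟨hp, fun r hr hlt => ?_⟩, hxp⟩
  rw [Set.disjoint_left]
  intro y hy hy'
  exact Nat.find_min hex (hpk ▸ hlt) ⟨r, hr, rfl, dy_nested hlt.le hy hy' hxp⟩

lemma iUnion_mx (F : Set (Cube N)) : ⋃ q ∈ mx F, dy q = ⋃ q ∈ F, dy q := by
  apply Subset.antisymm
  · exact biUnion_mono (mx_subset F) fun _ _ => Subset.rfl
  · intro x hx
    simp only [mem_iUnion] at hx ⊢
    obtain ⟨q, hq, hx⟩ := hx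
    obtain ⟨p, hp, h⟩ := exists_mx hq hx
    exact ⟨p, hp, h⟩

lemma mx_disjoint (F : Set (Cube N)) : (mx F).PairwiseDisjoint dy := by
  intro p hp q hq hne
  rcases lt_trichotomy p.1 q.1 with h | h | h
  · exact hq.2 p hp.1 h
  · rw [Function.onFun, Set.disjoint_left]
    intro x hx hx'
    exact hne (dy_same_level h hx hx')
  · exact (hp.2 q hq.1 h).symm

lemma dist_le_of_coord {x y : Euc N} {c : ℝ} (hc : 0 ≤ c) (h : ∀ i, |x i - y i| ≤ c) :
    dist x y ≤ N * c := by
  rw [EuclideanSpace.dist_eq]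
  apply Real.sqrt_le_iff.2 ⟨by positivity, ?_⟩
  calc ∑ i, dist (x i) (y i) ^ 2 ≤ ∑ i : Fin N, c ^ 2 := by
        refine Finset.sum_le_sum fun i _ => ?_
        rw [Real.dist_eq]
        exact pow_le_pow_left₀ (abs_nonneg _) (h i) 2
    _ = N * c ^ 2 := by simp
    _ ≤ (N:ℝ) ^ 2 * c ^ 2 := by
        gcongr
        have : N ≤ N ^ 2 := Nat.le_self_pow (by norm_num) N
        exact_mod_cast this
    _ = _ := by ring

/-- neighbour of a cube -/
def nbr (e : Fin N → Fin 3) (q : Cube N) : Cube N := (q.1, fun i => q.2 i + ((e i : ℕ) : ℤ) - 1)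

/-- the points of neighbouring cubes are close -/
lemma dist_nbr {q : Cube N} {e : Fin N → Fin 3} {x y : Euc N} (hx : x ∈ dy q)
    (hy : y ∈ dy (nbr e q)) : dist x y ≤ N * (2 * ((2:ℝ) ^ q.1)⁻¹) := by
  apply dist_le_of_coord (by positivity)
  intro i
  have h1 := Int.floor_eq_iff.1 (hx i)
  have h2 := Int.floor_eq_iff.1 (hy i)
  simp only [nbr] at h2
  have he : ((e i : ℕ) : ℝ) ≤ 2 := by
    have : (e i : ℕ) ≤ 2 := by have := (e i).2; omega
    exact_mod_cast this
  have he0 : (0:ℝ) ≤ ((e i : ℕ) : ℝ) := by positivity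
  push_cast at h2
  have h3 : (0:ℝ) < 2 ^ q.1 := by positivity
  rw [← div_eq_mul_inv, le_div_iff₀ h3]
  rw [← abs_of_pos h3, ← abs_mul, abs_le]
  constructor <;> nlinarith

lemma nbr_mem_nhds {q : Cube N} {x : Euc N} (hx : x ∈ dy q) :
    (⋃ e, dy (nbr e q)) ∈ 𝓝 x := by
  have h2 : (0:ℝ) < 2 ^ q.1 := by positivity
  have ho : IsOpen {y : Euc N | ∀ i, |(2:ℝ) ^ q.1 * (y i - x i)| < 1} := by
    simp only [setOf_forall]
    refine isOpen_iInter_of_finite fun i => ?_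
    exact isOpen_lt (by fun_prop) continuous_const
  refine mem_of_superset (ho.mem_nhds (by simp)) ?_
  intro y hy
  have key : ∀ i, ∃ e : Fin 3, ⌊(2:ℝ) ^ q.1 * y i⌋ = q.2 i + ((e : ℕ) : ℤ) - 1 := by
    intro i
    have h3 := abs_lt.1 (hy i)
    have h4 := Int.floor_eq_iff.1 (hx i)
    have l1 : q.2 i - 1 ≤ ⌊(2:ℝ) ^ q.1 * y i⌋ := by
      rw [Int.le_floor]; push_cast; nlinarith
    have l2 : ⌊(2:ℝ) ^ q.1 * y i⌋ < q.2 i + 2 := by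
      rw [Int.floor_lt]; push_cast; nlinarith
    refine ⟨⟨(⌊(2:ℝ) ^ q.1 * y i⌋ - q.2 i + 1).toNat, by omega⟩, ?_⟩
    simp only
    omega
  choose e he using key
  exact mem_iUnion.2 ⟨e, fun i => he i⟩

lemma div_cube {n : ℕ} (q : Cube (n + 1)) {φ : Euc (n + 1) → Euc (n + 1)} (hφ : ContDiff ℝ 1 φ)
    (hb : ∀ x, ‖φ x‖ ≤ 1) :
    ‖∫ x in dy q, diverg φ x‖ ≤ (n + 1) * (2 * (((2:ℝ) ^ q.1)⁻¹) ^ n) := by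
  have hle : lo q ≤ hi q := by
    intro i
    have := hi_sub_lo q i
    have : 0 < ((2:ℝ) ^ q.1)⁻¹ := by positivity
    linarith
  have hemb : MeasurableEmbedding (WithLp.ofLp : Euc (n + 1) → (Fin (n + 1) → ℝ)) :=
    (MeasurableEquiv.toLp 2 (Fin (n+1) → ℝ)).symm.measurableEmbedding
  have hae : dy q =ᵐ[volume] (WithLp.ofLp ⁻¹' (Icc (lo q) (hi q)) : Set (Euc (n + 1))) := by
    rw [dy_eq]
    refine (PiLp.volume_preserving_ofLp (Fin (n+1))).quasiMeasurePreserving.preimage_ae_eq ?_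
    exact Measure.univ_pi_Ico_ae_eq_Icc
  let T : (Fin (n + 1) → ℝ) →L[ℝ] Euc (n + 1) :=
    (PiLp.continuousLinearEquiv 2 ℝ (fun _ : Fin (n + 1) => ℝ)).symm.toContinuousLinearMap
  have hT : ∀ y, T y = WithLp.toLp 2 y := fun y => rfl
  let S : Euc (n + 1) →L[ℝ] (Fin (n + 1) → ℝ) :=
    (PiLp.continuousLinearEquiv 2 ℝ (fun _ : Fin (n + 1) => ℝ)).toContinuousLinearMap
  have hS : ∀ y, S y = WithLp.ofLp y := fun y => rfl
  have hdivT : ∀ y : Fin (n + 1) → ℝ, diverg φ (T y) =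
      ∑ i, (S.comp ((fderiv ℝ φ (T y)).comp T)) (Pi.single i 1) i := by
    intro y
    unfold diverg
    refine Finset.sum_congr rfl fun i _ => ?_
    rfl
  have hcd : Continuous fun y => diverg φ (T y) := (diverg_continuous hφ).comp T.continuous
  have e1 : ∫ x in dy q, diverg φ x = ∫ y in Icc (lo q) (hi q), diverg φ (T y) := by
    rw [setIntegral_congr_set hae, ← (PiLp.volume_preserving_ofLp (Fin (n+1))).setIntegral_preimage_emb
      hemb (fun y => diverg φ (T y))]
    rfl
  rw [e1]
  simp_rw [hdivT] at hcd ⊢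
  rw [integral_divergence_of_hasFDerivAt_off_countable (lo q) (hi q) hle (fun y => S (φ (T y)))
    (fun y => S.comp ((fderiv ℝ φ (T y)).comp T)) ∅ countable_empty]
  · refine (norm_sum_le _ _).trans ?_
    have hf : ∀ (i : Fin (n + 1)) (g : (Fin n → ℝ) → (Fin (n + 1) → ℝ)),
        ‖∫ x in Icc (lo q ∘ i.succAbove) (hi q ∘ i.succAbove), S (φ (T (g x))) i‖ ≤
          (((2:ℝ) ^ q.1)⁻¹) ^ n := by
      intro i g
      have hv : volume.real (Icc (lo q ∘ i.succAbove) (hi q ∘ i.succAbove)) =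
          (((2:ℝ) ^ q.1)⁻¹) ^ n := by
        rw [Measure.real, Real.volume_Icc_pi_toReal (a := lo q ∘ i.succAbove) (b := hi q ∘ i.succAbove) (fun j => hle _)]
        simp [hi_sub_lo]
      have := norm_setIntegral_le_of_norm_le_const (μ := volume)
        (s := Icc (lo q ∘ i.succAbove) (hi q ∘ i.succAbove))
        (f := fun x => S (φ (T (g x))) i) (C := 1) isCompact_Icc.measure_lt_top
        (fun x _ => (PiLp.norm_apply_le _ i).trans (hb _))
      rwa [hv, one_mul] at this
    calc _ ≤ ∑ i : Fin (n + 1), (2 * (((2:ℝ) ^ q.1)⁻¹) ^ n) := by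
          refine Finset.sum_le_sum fun i _ => ?_
          refine (norm_sub_le _ _).trans ?_
          have h1 := hf i (fun x => i.insertNth (hi q i) x)
          have h2 := hf i (fun x => i.insertNth (lo q i) x)
          rw [two_mul]
          exact add_le_add h1 h2
      _ = _ := by simp
  · exact (S.continuous.comp (hφ.continuous.comp T.continuous)).continuousOn
  · intro x _
    have h1 : HasFDerivAt φ (fderiv ℝ φ (T x)) (T x) :=
      (hφ.differentiable (by norm_num) _).hasFDerivAt
    exact S.hasFDerivAt.comp x (h1.comp x T.hasFDerivAt)
  · exact hcd.continuousOn.integrableOn_compact isCompact_Icc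

lemma perimeter_cubes {n : ℕ} (F : Set (Cube (n + 1))) (U Ω' : Set (Euc (n + 1)))
    (hU : U =ᵐ[volume] (⋃ q ∈ F, dy q : Set (Euc (n + 1)))) :
    perimeter U Ω' ≤ ENNReal.ofReal ((n + 1) * 2) *
      ∑' q : {q | q ∈ F ∧ (dy q ∩ Ω').Nonempty}, sd q.1.1 ^ n := by
  set G : Set (Cube (n + 1)) := {q | q ∈ F ∧ (dy q ∩ Ω').Nonempty}
  rw [perimeter_congr hU, ← iUnion_mx]
  refine iSup₂_le fun φ hφ => ?_
  have hintg := diverg_integrable hφ.1 hφ.2.1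
  have e1 : ∫ x in ⋃ q ∈ mx F, dy q, diverg φ x = ∑' q : mx F, ∫ x in dy q.1, diverg φ x := by
    rw [biUnion_eq_iUnion]
    refine integral_iUnion (fun q => measurableSet_dy _) ?_ hintg.integrableOn
    intro p q hpq
    exact mx_disjoint F p.2 q.2 (fun h => hpq (Subtype.ext h))
  rw [e1]
  calc ENNReal.ofReal (∑' q : mx F, ∫ x in dy q.1, diverg φ x)
      ≤ ‖∑' q : mx F, ∫ x in dy q.1, diverg φ x‖ₑ := by
        rw [← ofReal_norm_eq_enorm]
        exact ENNReal.ofReal_le_ofReal (le_abs_self _)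
    _ ≤ ∑' q : mx F, ‖∫ x in dy q.1, diverg φ x‖ₑ := enorm_tsum_le_tsum_enorm
    _ = ∑' q, (mx F).indicator (fun q => ‖∫ x in dy q, diverg φ x‖ₑ) q := by
        rw [← tsum_subtype]
    _ ≤ ∑' q, G.indicator (fun q => ENNReal.ofReal ((n + 1) * 2) * sd q.1 ^ n) q := by
        refine ENNReal.tsum_le_tsum fun q => ?_
        by_cases hq : q ∈ mx F
        · rw [indicator_of_mem hq]
          by_cases hG : q ∈ G
          · rw [indicator_of_mem hG, sd_eq, ← ENNReal.ofReal_pow (by positivity),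
              ← ENNReal.ofReal_mul (by positivity), ← ofReal_norm_eq_enorm]
            refine ENNReal.ofReal_le_ofReal ((div_cube q hφ.1 hφ.2.2.2).trans_eq (by ring))
          · rw [indicator_of_notMem hG]
            have : ∫ x in dy q, diverg φ x = 0 := by
              rw [setIntegral_congr_fun (g := fun _ => 0) (measurableSet_dy q)]
              · simp
              · intro x hx
                apply diverg_eq_zero
                intro h
                exact hG ⟨hq.1, x, hx, hφ.2.2.1 h⟩
            simp [this]
        · rw [indicator_of_notMem hq]; exact zero_le
    _ = _ := by rw [← tsum_subtype, ENNReal.tsum_mul_left]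

lemma interior_cubes_ae {F : Set (Cube N)} :
    (interior (⋃ q ∈ F, dy q) : Set (Euc N)) =ᵐ[volume] (⋃ q ∈ F, dy q : Set (Euc N)) := by
  have h1 : (⋃ q ∈ F, dyo q : Set (Euc N)) =ᵐ[volume] (⋃ q ∈ F, dy q : Set (Euc N)) :=
    EventuallyEq.countable_bUnion F.to_countable fun q _ => dyo_ae_eq q
  have h2 : (⋃ q ∈ F, dyo q : Set (Euc N)) ⊆ interior (⋃ q ∈ F, dy q) :=
    interior_maximal (iUnion₂_mono fun q _ => dyo_subset q)
      (isOpen_biUnion fun q _ => isOpen_dyo q)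
  refine (ae_le_set.2 ?_).antisymm (h1.symm.le.trans (HasSubset.Subset.eventuallyLE h2))
  rw [sdiff_eq_empty.2 interior_subset]; simp

lemma nbr_one (q : Cube N) : nbr (fun _ => 1) q = q := by
  refine Prod.ext rfl ?_
  funext i
  simp [nbr]

lemma dist_dy {q : Cube N} {x y : Euc N} (hx : x ∈ dy q) (hy : y ∈ dy q) :
    dist x y ≤ N * (2 * ((2:ℝ) ^ q.1)⁻¹) := by
  apply dist_nbr (e := fun _ => 1) hx
  rwa [nbr_one]

/-- the volume of balls of radius comparable to `2^{-k}` -/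
lemma volume_ball_sd {n : ℕ} (c : ℝ) (hc : 0 ≤ c) (x : Euc (n+1)) (k : ℕ) :
    volume (closedBall x (c * ((2:ℝ) ^ k)⁻¹)) =
      (ENNReal.ofReal c ^ (n+1) * volume (ball (0 : Euc (n+1)) 1)) * sd k ^ (n+1) := by
  rw [Measure.addHaar_closedBall _ _ (by positivity), mul_pow, ENNReal.ofReal_mul (by positivity),
    sd_eq, ENNReal.ofReal_pow hc, ENNReal.ofReal_pow (by positivity)]
  simp only [finrank_euclideanSpace, Fintype.card_fin]
  ring

lemma dy_inter_vol (q : Cube N) (A : Set (Euc N)) : volume (dyo q ∩ A) = volume (dy q ∩ A) :=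
  measure_congr ((dyo_ae_eq q).inter (ae_eq_refl A))

lemma dy_diff_vol (q : Cube N) (A : Set (Euc N)) : volume (dyo q \ A) = volume (dy q \ A) :=
  measure_congr ((dyo_ae_eq q).diff (ae_eq_refl A))

lemma poincare_cube (n : ℕ) : ∃ C : ℝ≥0∞, C ≠ ⊤ ∧ ∀ (A : Set (Euc (n+1))) (_ : MeasurableSet A)
    (q : Cube (n+1)), volume (dy q ∩ A) * volume (dy q \ A) ≤
      C * (sd q.1 ^ (n+2) * perimeter A (dyo q)) := by
  refine ⟨(ENNReal.ofReal ((n+1:ℕ) * 2) ^ (n+1) * volume (ball (0 : Euc (n+1)) 1)) *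
    ENNReal.ofReal ((n+1:ℕ) * 2), ?_, ?_⟩
  · refine ENNReal.mul_ne_top (ENNReal.mul_ne_top (by simp) measure_ball_lt_top.ne) (by simp)
  intro A hA q
  have := poincare hA (isOpen_dyo q) (convex_dyo q)
    (by rw [volume_dyo, ← volume_dy]; exact volume_dy_ne_top q)
    ((((n+1:ℕ):ℝ) * 2) * ((2:ℝ) ^ q.1)⁻¹)
    (fun x hx y hy => by
      rw [mul_assoc]; exact dist_dy (dyo_subset q hx) (dyo_subset q hy))
  rw [volume_ball_sd _ (by positivity), dy_inter_vol, dy_diff_vol] at this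
  refine this.trans (le_of_eq ?_)
  rw [ENNReal.ofReal_mul (p := ((n+1:ℕ):ℝ) * 2) (by positivity), ← sd_eq]
  ring

lemma half_split {A : Set (Euc N)} (hA : MeasurableSet A) (q : Cube N) :
    volume (dy q ∩ A) + volume (dy q \ A) = sd q.1 ^ N := by
  rw [measure_inter_add_diff _ hA, volume_dy]

lemma sdN_ne_zero (k m : ℕ) : sd k ^ m ≠ 0 := pow_ne_zero _ (sd_ne_zero k)
lemma sdN_ne_top (k m : ℕ) : sd k ^ m ≠ ⊤ := ENNReal.pow_ne_top (sd_ne_top k)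

lemma start_est (n : ℕ) : ∃ C : ℝ≥0∞, C ≠ ⊤ ∧ ∀ (A : Set (Euc (n+1))) (_ : MeasurableSet A)
    (q : Cube (n+1)), 2⁻¹ * sd q.1 ^ (n+1) ≤ volume (dy q ∩ A) →
      volume (dy q \ A) ≤ C * (sd q.1 * perimeter A (dyo q)) := by
  obtain ⟨C, hC, h⟩ := poincare_cube n
  refine ⟨2 * C, ENNReal.mul_ne_top (by simp) hC, fun A hA q hq => ?_⟩
  have h1 := h A hA q
  have h2 : sd q.1 ^ (n+1) * volume (dy q \ A) ≤
      sd q.1 ^ (n+1) * (2 * C * (sd q.1 * perimeter A (dyo q))) := by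
    calc sd q.1 ^ (n+1) * volume (dy q \ A)
        = 2 * ((2⁻¹ * sd q.1 ^ (n+1)) * volume (dy q \ A)) := by
          rw [← mul_assoc, ← mul_assoc, ENNReal.mul_inv_cancel (by simp) (by simp), one_mul]
      _ ≤ 2 * (volume (dy q ∩ A) * volume (dy q \ A)) := by gcongr
      _ ≤ 2 * (C * (sd q.1 ^ (n+2) * perimeter A (dyo q))) := by gcongr
      _ = _ := by ring
  exact (ENNReal.mul_le_mul_iff_right (sdN_ne_zero _ _) (sdN_ne_top _ _)).1 h2

lemma bdry_est (n : ℕ) : ∃ C : ℝ≥0∞, C ≠ ⊤ ∧ ∀ (A : Set (Euc (n+1))) (_ : MeasurableSet A)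
    (q : Cube (n+1)), 2⁻¹ ^ (n+2) * sd q.1 ^ (n+1) ≤ volume (dy q ∩ A) →
      volume (dy q ∩ A) ≤ 2⁻¹ * sd q.1 ^ (n+1) →
      sd q.1 ^ n ≤ C * perimeter A (dyo q) := by
  obtain ⟨C, hC, h⟩ := poincare_cube n
  refine ⟨2 ^ (n+3) * C, ENNReal.mul_ne_top (by simp) hC, fun A hA q hq1 hq2 => ?_⟩
  have h1 := h A hA q
  have h3 : 2⁻¹ * sd q.1 ^ (n+1) ≤ volume (dy q \ A) := by
    have e := half_split hA q
    have e2 : sd q.1 ^ (n+1) = 2⁻¹ * sd q.1 ^ (n+1) + 2⁻¹ * sd q.1 ^ (n+1) := by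
      rw [← add_mul, ENNReal.inv_two_add_inv_two, one_mul]
    rw [e2] at e
    have : 2⁻¹ * sd q.1 ^ (n+1) + 2⁻¹ * sd q.1 ^ (n+1) ≤
        2⁻¹ * sd q.1 ^ (n+1) + volume (dy q \ A) := by rw [← e]; gcongr
    exact (ENNReal.add_le_add_iff_left (ENNReal.mul_ne_top (by simp) (sdN_ne_top _ _))).1 this
  have h2 : sd q.1 ^ (n+2) * sd q.1 ^ n ≤
      sd q.1 ^ (n+2) * (2 ^ (n+3) * C * perimeter A (dyo q)) := by
    have e3 : (2:ℝ≥0∞) ^ (n+3) * (2⁻¹ ^ (n+2) * 2⁻¹) = 1 := by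
      rw [← pow_succ, ← mul_pow, ENNReal.mul_inv_cancel (by simp) (by simp), one_pow]
    calc sd q.1 ^ (n+2) * sd q.1 ^ n
        = (2:ℝ≥0∞) ^ (n+3) * (2⁻¹ ^ (n+2) * 2⁻¹) * (sd q.1 ^ (n+2) * sd q.1 ^ n) := by
          rw [e3, one_mul]
      _ = 2 ^ (n+3) * ((2⁻¹ ^ (n+2) * sd q.1 ^ (n+1)) * (2⁻¹ * sd q.1 ^ (n+1))) := by ring
      _ ≤ 2 ^ (n+3) * (volume (dy q ∩ A) * volume (dy q \ A)) := by gcongr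
      _ ≤ 2 ^ (n+3) * (C * (sd q.1 ^ (n+2) * perimeter A (dyo q))) := by gcongr
      _ = _ := by ring
  exact (ENNReal.mul_le_mul_iff_right (sdN_ne_zero _ _) (sdN_ne_top _ _)).1 h2

/-- at points of density one, all small dyadic cubes are at least half full -/
lemma density_cubes {n : ℕ} {A : Set (Euc (n+1))} (hA : MeasurableSet A) {x : Euc (n+1)}
    (hx : HasDensity A x 1) (k0 : ℕ) :
    ∃ k ≥ k0, 2⁻¹ * sd k ^ (n+1) ≤ volume (dy (k, idx k x) ∩ A) := by
  set c : ℝ := ((n+1:ℕ):ℝ) * 2 + 1 with hc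
  have hcpos : 0 < c := by positivity
  set M : ℝ≥0∞ := ENNReal.ofReal c ^ (n+1) * volume (ball (0 : Euc (n+1)) 1) with hM
  have hM0 : M ≠ 0 := mul_ne_zero (by simp [hcpos]) (measure_ball_pos _ _ one_pos).ne'
  have hMt : M ≠ ⊤ := ENNReal.mul_ne_top (by simp) measure_ball_lt_top.ne
  set t : ℝ≥0∞ := 2⁻¹ / M with ht
  have ht0 : t ≠ 0 := by simp [ht, hMt, ENNReal.div_eq_zero_iff]
  have hlim : Tendsto (fun k : ℕ => c * ((2:ℝ)^k)⁻¹) atTop (𝓝[>] 0) := by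
    apply tendsto_nhdsWithin_iff.2 ⟨?_, Eventually.of_forall fun k => by
      show 0 < c * ((2:ℝ)^k)⁻¹; positivity⟩
    have : Tendsto (fun k : ℕ => ((2:ℝ)^k)⁻¹) atTop (𝓝 0) := by
      simpa using tendsto_pow_atTop_nhds_zero_of_lt_one (r := (2:ℝ)⁻¹) (by norm_num) (by norm_num)
    simpa using this.const_mul c
  have h1 := hx.comp hlim
  rw [ENNReal.ofReal_one] at h1
  have h2 := (h1.eventually (lt_mem_nhds (ENNReal.sub_lt_self ENNReal.one_ne_top one_ne_zero ht0)))
  obtain ⟨k, hk, hkk⟩ := (h2.and (eventually_ge_atTop k0)).exists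
  refine ⟨k, hkk, ?_⟩
  set ρ := c * ((2:ℝ)^k)⁻¹ with hρ
  have hρ0 : 0 < ρ := by positivity
  have hb : volume (ball x ρ) = M * sd k ^ (n+1) := by
    rw [← Measure.addHaar_closedBall_eq_addHaar_ball, hρ, volume_ball_sd _ hcpos.le]
  have hb0 : volume (ball x ρ) ≠ 0 := (measure_ball_pos _ _ hρ0).ne'
  have hbt : volume (ball x ρ) ≠ ⊤ := measure_ball_lt_top.ne
  have h3 : (1 - t) * volume (ball x ρ) ≤ volume (A ∩ ball x ρ) := by
    have : 1 - t ≤ volume (A ∩ ball x ρ) / volume (ball x ρ) := hk.le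
    exact (ENNReal.le_div_iff_mul_le (Or.inl hb0) (Or.inl hbt)).1 this
  have h4 : volume (ball x ρ \ A) ≤ t * volume (ball x ρ) := by
    have e : volume (A ∩ ball x ρ) + volume (ball x ρ \ A) = volume (ball x ρ) := by
      rw [inter_comm]; exact measure_inter_add_diff _ hA
    have e5 : volume (ball x ρ) ≤ (1 - t) * volume (ball x ρ) + t * volume (ball x ρ) := by
      rw [← add_mul]
      calc volume (ball x ρ) = 1 * volume (ball x ρ) := (one_mul _).symm
        _ ≤ _ := by gcongr; exact le_tsub_add
    have : volume (A ∩ ball x ρ) + volume (ball x ρ \ A) ≤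
        volume (A ∩ ball x ρ) + t * volume (ball x ρ) := by
      rw [e]; refine e5.trans ?_; gcongr
    refine (ENNReal.add_le_add_iff_left ?_).1 this
    exact ne_top_of_le_ne_top hbt (measure_mono inter_subset_right)
  have hsub : dy (k, idx k x) ⊆ ball x ρ := by
    intro y hy
    rw [mem_ball]
    have h := dist_dy hy (mem_dy_idx k x)
    refine h.trans_lt ?_
    have : 0 < ((2:ℝ)^k)⁻¹ := by positivity
    simp only [hρ, hc]
    nlinarith
  have h5 : volume (dy (k, idx k x) \ A) ≤ 2⁻¹ * sd k ^ (n+1) := by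
    refine (measure_mono (sdiff_subset_sdiff_left hsub)).trans (h4.trans (le_of_eq ?_))
    rw [hb, ← mul_assoc, ht, ENNReal.div_mul_cancel hM0 hMt]
  have e := half_split hA (k, idx k x)
  have e2 : sd k ^ (n+1) = 2⁻¹ * sd k ^ (n+1) + 2⁻¹ * sd k ^ (n+1) := by
    rw [← add_mul, ENNReal.inv_two_add_inv_two, one_mul]
  have h6 : 2⁻¹ * sd k ^ (n+1) + 2⁻¹ * sd k ^ (n+1) ≤
      volume (dy (k, idx k x) ∩ A) + 2⁻¹ * sd k ^ (n+1) := by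
    rw [← e2]; refine e.symm.le.trans ?_; gcongr
  exact (ENNReal.add_le_add_iff_right (ENNReal.mul_ne_top (by simp) (sdN_ne_top _ _))).1 h6

lemma volume_cubes_le {n : ℕ} (F : Set (Cube (n+1))) (k0 : ℕ) (hF : ∀ q ∈ F, k0 ≤ q.1) :
    volume (⋃ q ∈ F, dy q) ≤ sd k0 * ∑' q : F, sd q.1.1 ^ n := by
  refine (measure_biUnion_le volume F.to_countable dy).trans ?_
  rw [← ENNReal.tsum_mul_left]
  refine ENNReal.tsum_le_tsum fun q => ?_
  rw [volume_dy, pow_succ, mul_comm]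
  gcongr
  exact sd_le (hF q q.2)

lemma nbr_injective (e : Fin N → Fin 3) : Function.Injective (nbr e) := by
  intro p q h
  have h1 := congrArg Prod.fst h
  have h2 := congrArg Prod.snd h
  refine Prod.ext h1 ?_
  funext i
  have := congrFun h2 i
  simp only [nbr] at this
  omega

lemma bdry_family (n : ℕ) : ∃ C : ℝ≥0∞, C ≠ ⊤ ∧ ∀ (A : Set (Euc (n+1))) (_ : MeasurableSet A)
    (V : Set (Euc (n+1))) (R : Set (Cube (n+1))) (k0 : ℕ), (∀ q ∈ R, k0 ≤ q.1) →
    (∀ q ∈ R, ∀ e, dy (nbr e q) ⊆ V) →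
    (∀ q ∈ R, 2⁻¹ ^ (n+2) * sd q.1 ^ (n+1) ≤ volume (dy q ∩ A)) →
    (∀ q ∈ R, volume (dy q ∩ A) ≤ 2⁻¹ * sd q.1 ^ (n+1)) →
    ∃ F : Set (Cube (n+1)), (∀ q ∈ F, k0 ≤ q.1) ∧ (∀ q ∈ F, dy q ⊆ V) ∧
      (∀ q ∈ R, dy q ⊆ interior (⋃ q ∈ F, dy q)) ∧
      ∑' q : F, sd q.1.1 ^ n ≤ C * perimeter A V := by
  obtain ⟨C, hC, h⟩ := bdry_est n
  refine ⟨Fintype.card (Fin (n+1) → Fin 3) * C, ENNReal.mul_ne_top (by simp) hC, ?_⟩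
  intro A hA V R k0 hk hV h1 h2
  refine ⟨⋃ e, nbr e '' mx R, ?_, ?_, ?_, ?_⟩
  · intro q hq
    obtain ⟨e, p, hp, rfl⟩ := mem_iUnion.1 hq
    exact hk p hp.1
  · intro q hq
    obtain ⟨e, p, hp, rfl⟩ := mem_iUnion.1 hq
    exact hV p hp.1 e
  · intro q hq x hx
    obtain ⟨p, hp, hxp⟩ := exists_mx hq hx
    rw [mem_interior_iff_mem_nhds]
    filter_upwards [nbr_mem_nhds hxp] with y hy
    obtain ⟨e, he⟩ := mem_iUnion.1 hy
    exact mem_biUnion (mem_iUnion.2 ⟨e, p, hp, rfl⟩) he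
  · have hsum : ∑' q : mx R, sd q.1.1 ^ n ≤ C * perimeter A V := by
      calc ∑' q : mx R, sd q.1.1 ^ n ≤ ∑' q : mx R, C * perimeter A (dyo q.1) :=
            ENNReal.tsum_le_tsum fun q => h A hA q.1 (h1 _ q.2.1) (h2 _ q.2.1)
        _ = C * ∑' q : mx R, perimeter A (dyo q.1) := ENNReal.tsum_mul_left
        _ ≤ _ := by
            gcongr
            apply perimeter_tsum_le (fun q : mx R => dyo q.1)
            · intro p q hpq
              exact (mx_disjoint R p.2 q.2 (fun h => hpq (Subtype.ext h))).mono
                (dyo_subset _) (dyo_subset _)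
            · intro q
              refine (dyo_subset _).trans ?_
              have := hV _ q.2.1 (fun _ => 1)
              rwa [nbr_one] at this
    calc ∑' q : (⋃ e, nbr e '' mx R : Set (Cube (n+1))), sd q.1.1 ^ n
        ≤ ∑ e, ∑' q : nbr e '' mx R, sd q.1.1 ^ n :=
          ENNReal.tsum_iUnion_le (fun q : Cube (n+1) => sd q.1 ^ n) (fun e => nbr e '' mx R)
      _ = ∑ e : Fin (n+1) → Fin 3, ∑' q : mx R, sd q.1.1 ^ n := by
          refine Finset.sum_congr rfl fun e _ => ?_
          rw [tsum_image (fun q : Cube (n+1) => sd q.1 ^ n) (nbr_injective e).injOn]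
          rfl
      _ ≤ ∑ e : Fin (n+1) → Fin 3, C * perimeter A V := Finset.sum_le_sum fun _ _ => hsum
      _ = _ := by simp [mul_assoc]

lemma convex_dy (q : Cube N) : Convex ℝ (dy q) := by
  have : Convex ℝ (univ.pi fun i => Ico (lo q i) (hi q i)) := convex_pi fun i _ => convex_Ico _ _
  rw [dy_eq]
  exact this.linear_preimage (WithLp.linearEquiv 2 ℝ (Fin N → ℝ)).toLinearMap

lemma volume_closure_dy (q : Cube N) : volume (closure (dy q) \ dy q) = 0 := by
  refine measure_mono_null ?_ ((convex_dy q).addHaar_frontier volume)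
  exact sdiff_subset_sdiff_right interior_subset

lemma isBounded_dy (q : Cube N) : Bornology.IsBounded (dy q) :=
  isBounded_iff.2 ⟨_, fun _ hx _ hy => dist_dy hx hy⟩

/-- finitely many cubes of a given level meet a bounded set -/
lemma finite_level (k : ℕ) {K : Set (Euc N)} (hK : Bornology.IsBounded K) :
    {q : Cube N | q.1 = k ∧ (dy q ∩ K).Nonempty}.Finite := by
  obtain ⟨R, hR⟩ := hK.exists_norm_le
  obtain ⟨M, hM⟩ := exists_nat_gt ((2:ℝ) ^ k * R)
  have hfin : (({k} : Set ℕ) ×ˢ (Icc (fun _ => -(M:ℤ) - 1) (fun _ => (M:ℤ) + 1) :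
      Set (Fin N → ℤ))).Finite := (finite_singleton k).prod (finite_Icc _ _)
  refine hfin.subset ?_
  rintro ⟨l, a⟩ ⟨rfl, x, hx, hxK⟩
  refine ⟨rfl, ?_⟩
  have key : ∀ i, -(M:ℤ) - 1 ≤ a i ∧ a i ≤ (M:ℤ) + 1 := by
    intro i
    have h1 := Int.floor_eq_iff.1 (hx i)
    have h2 : |x i| ≤ R := (PiLp.norm_apply_le x i).trans (hR x hxK)
    have h3 := abs_le.1 h2
    have hp : (0:ℝ) < 2 ^ l := by positivity
    have h4 : (2:ℝ) ^ l * x i ≤ 2 ^ l * R := by gcongr; exact h3.2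
    have h5 : -((2:ℝ) ^ l * R) ≤ 2 ^ l * x i := by nlinarith [h3.1]
    dsimp only at h1 hM
    constructor
    · have : (-(M:ℤ) - 1 : ℝ) ≤ a i := by push_cast; linarith [h1.2]
      exact_mod_cast this
    · have : (a i : ℝ) ≤ ((M:ℤ):ℝ) + 1 := by push_cast; linarith [h1.1]
      exact_mod_cast this
  exact ⟨fun i => (key i).1, fun i => (key i).2⟩

/-- uniform smallness of cubes and neighbours near a compact set -/
lemma exists_level {K O : Set (Euc N)} (hK : IsCompact K) (hO : IsOpen O) (h : K ⊆ O) :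
    ∃ k0 : ℕ, ∀ q : Cube N, k0 ≤ q.1 → (dy q ∩ K).Nonempty → ∀ e, closure (dy (nbr e q)) ⊆ O := by
  obtain ⟨δ, hδ, hs⟩ := hK.exists_cthickening_subset_open hO h
  have hl : Tendsto (fun k : ℕ => (N:ℝ) * (2 * ((2:ℝ)^k)⁻¹)) atTop (𝓝 0) := by
    have : Tendsto (fun k : ℕ => ((2:ℝ)^k)⁻¹) atTop (𝓝 0) := by
      simpa using tendsto_pow_atTop_nhds_zero_of_lt_one (r := (2:ℝ)⁻¹) (by norm_num) (by norm_num)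
    simpa using (this.const_mul 2).const_mul (N:ℝ)
  obtain ⟨k0, hk0⟩ := eventually_atTop.1 (hl.eventually (gt_mem_nhds hδ))
  refine ⟨k0, fun q hq ⟨x, hx, hxK⟩ e => ?_⟩
  refine (closure_minimal ?_ isClosed_cthickening).trans hs
  intro y hy
  refine mem_cthickening_of_dist_le y x δ K hxK ?_
  rw [dist_comm]
  exact (dist_nbr hx hy).trans (hk0 _ hq).le

/-- covering of a compact set by finitely many cubes -/
lemma cover_compact {n : ℕ} {K O : Set (Euc (n+1))} (hK : IsCompact K) (hO : IsOpen O)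
    (h : K ⊆ O) : ∃ T : Set (Cube (n+1)), T.Finite ∧ (∀ q ∈ T, dy q ⊆ O) ∧
      K ⊆ interior (⋃ q ∈ T, dy q) := by
  obtain ⟨k0, hk0⟩ := exists_level hK hO h
  refine ⟨⋃ e, nbr e '' {q : Cube (n+1) | q.1 = k0 ∧ (dy q ∩ K).Nonempty}, ?_, ?_, ?_⟩
  · exact finite_iUnion fun e => (finite_level k0 hK.isBounded).image _
  · intro q hq
    obtain ⟨e, p, hp, rfl⟩ := mem_iUnion.1 hq
    exact subset_closure.trans (hk0 p hp.1.ge hp.2 e)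
  · intro x hx
    have hxp := mem_dy_idx k0 x
    rw [mem_interior_iff_mem_nhds]
    filter_upwards [nbr_mem_nhds hxp] with y hy
    obtain ⟨e, he⟩ := mem_iUnion.1 hy
    exact mem_biUnion (mem_iUnion.2 ⟨e, _, ⟨rfl, x, hxp, hx⟩, rfl⟩) he

lemma start_family (n : ℕ) : ∃ C : ℝ≥0∞, C ≠ ⊤ ∧ ∀ (A : Set (Euc (n+1))) (_ : MeasurableSet A)
    (V : Set (Euc (n+1))) (_ : IsOpen V) (G : Set (Cube (n+1))) (_ : G.Finite) (k0 : ℕ),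
    (∀ q ∈ G, q.1 = k0) → (∀ q ∈ G, closure (dy q) ⊆ V) →
    (∀ q ∈ G, 2⁻¹ * sd q.1 ^ (n+1) ≤ volume (dy q ∩ A)) → ∀ η : ℝ≥0∞, η ≠ 0 →
    ∃ T : Set (Cube (n+1)), T.Finite ∧ (∀ q ∈ T, dy q ⊆ V) ∧
      (∀ q ∈ G, dy q ⊆ interior (⋃ q ∈ T, dy q)) ∧
      volume ((⋃ q ∈ T, dy q) \ A) ≤ η + C * (sd k0 * perimeter A V) := by
  obtain ⟨C, hC, h⟩ := start_est n
  refine ⟨C, hC, ?_⟩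
  intro A hA V hV G hG k0 hk hGV hhalf η hη
  set K : Set (Euc (n+1)) := ⋃ q ∈ G, closure (dy q) with hKdef
  have hK : IsCompact K := hG.isCompact_biUnion fun q _ => (isBounded_dy q).isCompact_closure
  have hKV : K ⊆ V := iUnion₂_subset hGV
  obtain ⟨O, hKO, hO, -, hOv⟩ :=
    hK.measurableSet.exists_isOpen_diff_lt (μ := volume) hK.measure_lt_top.ne hη
  obtain ⟨T, hT, hTO, hTK⟩ := cover_compact hK (hO.inter hV) (subset_inter hKO hKV)
  refine ⟨T, hT, fun q hq => (hTO q hq).trans inter_subset_right, ?_, ?_⟩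
  · intro q hq
    exact (subset_closure.trans (subset_biUnion_of_mem (u := fun q => closure (dy q)) hq)).trans hTK
  · have hKA : volume (K \ A) ≤ C * (sd k0 * perimeter A V) := by
      have hsub : K \ A ⊆ (⋃ q ∈ G, (dy q \ A)) ∪ ⋃ q ∈ G, (closure (dy q) \ dy q) := by
        rintro x ⟨hx, hxA⟩
        obtain ⟨q, hq, hxq⟩ := mem_iUnion₂.1 hx
        by_cases hxd : x ∈ dy q
        · exact Or.inl (mem_biUnion hq ⟨hxd, hxA⟩)
        · exact Or.inr (mem_biUnion hq ⟨hxq, hxd⟩)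
      have hnull : volume (⋃ q ∈ G, (closure (dy q) \ dy q)) = 0 :=
        (measure_biUnion_null_iff hG.countable).2 fun q _ => volume_closure_dy q
      calc volume (K \ A) ≤ volume (⋃ q ∈ G, (dy q \ A)) + 0 := by
            rw [← hnull]; exact (measure_mono hsub).trans (measure_union_le _ _)
        _ ≤ ∑' q : G, volume (dy q.1 \ A) := by
            rw [add_zero]; exact measure_biUnion_le volume hG.countable _
        _ ≤ ∑' q : G, C * (sd k0 * perimeter A (dyo q.1)) := by
            refine ENNReal.tsum_le_tsum fun q => ?_
            have := h A hA q.1 (hhalf _ q.2)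
            rwa [hk _ q.2] at this
        _ = C * (sd k0 * ∑' q : G, perimeter A (dyo q.1)) := by
            rw [ENNReal.tsum_mul_left, ENNReal.tsum_mul_left]
        _ ≤ _ := by
            gcongr
            apply perimeter_tsum_le (fun q : G => dyo q.1)
            · intro p q hpq
              rw [Function.onFun, Set.disjoint_left]
              intro x hx hx'
              exact hpq (Subtype.ext (dy_same_level ((hk _ p.2).trans (hk _ q.2).symm)
                (dyo_subset _ hx) (dyo_subset _ hx')))
            · exact fun q => (dyo_subset _).trans (subset_closure.trans (hGV _ q.2))
    have hsub : (⋃ q ∈ T, dy q) \ A ⊆ (O \ K) ∪ (K \ A) := by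
      rintro x ⟨hx, hxA⟩
      obtain ⟨q, hq, hxq⟩ := mem_iUnion₂.1 hx
      by_cases hxK : x ∈ K
      · exact Or.inr ⟨hxK, hxA⟩
      · exact Or.inl ⟨(hTO q hq hxq).1, hxK⟩
    exact (measure_mono hsub).trans ((measure_union_le _ _).trans (add_le_add hOv.le hKA))

lemma tendsto_sd_mul {C : ℝ≥0∞} (hC : C ≠ ⊤) : Tendsto (fun k => sd k * C) atTop (𝓝 0) := by
  have : Tendsto sd atTop (𝓝 0) :=
    ENNReal.tendsto_pow_atTop_nhds_zero_of_lt_one (by simp [ENNReal.inv_lt_one])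
  simpa using ENNReal.Tendsto.mul_const this (Or.inr hC)

lemma local_family {n : ℕ} {A : Set (Euc (n+1))} (hA : MeasurableSet A)
    {S V : Set (Euc (n+1))} (hS : IsCompact S) (hV : IsOpen V) (hSV : S ⊆ V)
    (hP : perimeter A V ≠ ⊤) {η : ℝ≥0∞} (hη : η ≠ 0) :
    ∃ F : Set (Cube (n+1)), (∀ q ∈ F, dy q ⊆ V) ∧
      (∀ x ∈ S, HasDensity A x 1 → x ∈ interior (⋃ q ∈ F, dy q)) ∧
      volume ((⋃ q ∈ F, dy q) \ A) ≤ η ∧ ∑' q : F, sd q.1.1 ^ n ≠ ⊤ := by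
  classical
  obtain ⟨C1, hC1, hstart⟩ := start_family n
  obtain ⟨C2, hC2, hbdry⟩ := bdry_family n
  obtain ⟨k1, hk1⟩ := exists_level hS hV hSV
  have hη2 : η / 2 ≠ 0 := by simp [hη]
  have hη4 : η / 2 / 2 ≠ 0 := by simp [hη]
  have hCt : C1 * perimeter A V + C2 * perimeter A V ≠ ⊤ :=
    ENNReal.add_ne_top.2 ⟨ENNReal.mul_ne_top hC1 hP, ENNReal.mul_ne_top hC2 hP⟩
  obtain ⟨k0, hk0s, hk01⟩ := (((tendsto_sd_mul hCt).eventually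
    (gt_mem_nhds (pos_iff_ne_zero.2 hη2))).and (eventually_ge_atTop k1)).exists
  have hlev : ∀ q : Cube (n+1), k0 ≤ q.1 → (dy q ∩ S).Nonempty → ∀ e, closure (dy (nbr e q)) ⊆ V :=
    fun q hq => hk1 q (hk01.trans hq)
  set R : Set (Cube (n+1)) := {q | k0 ≤ q.1 ∧ (dy q ∩ S).Nonempty ∧
    2⁻¹ ^ (n+2) * sd q.1 ^ (n+1) ≤ volume (dy q ∩ A) ∧
    volume (dy q ∩ A) ≤ 2⁻¹ * sd q.1 ^ (n+1)} with hR
  set G : Set (Cube (n+1)) := {q | (q.1 = k0 ∧ (dy q ∩ S).Nonempty) ∧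
    2⁻¹ * sd q.1 ^ (n+1) ≤ volume (dy q ∩ A)} with hG
  obtain ⟨F, hFk, hFV, hFR, hFs⟩ := hbdry A hA V R k0 (fun q hq => hq.1)
    (fun q hq e => subset_closure.trans (hlev q hq.1 hq.2.1 e)) (fun q hq => hq.2.2.1)
    (fun q hq => hq.2.2.2)
  obtain ⟨T, hT, hTV, hTG, hTv⟩ := hstart A hA V hV G
    ((finite_level k0 hS.isBounded).subset fun q hq => hq.1) k0 (fun q hq => hq.1.1)
    (fun q hq => by
      have := hlev q hq.1.1.ge hq.1.2 (fun _ => 1)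
      rwa [nbr_one] at this) (fun q hq => hq.2) (η / 2) hη2
  refine ⟨F ∪ T, ?_, ?_, ?_, ?_⟩
  · rintro q (hq | hq)
    exacts [hFV q hq, hTV q hq]
  · intro x hxS hxd
    have hex : ∃ k, k0 ≤ k ∧ 2⁻¹ * sd k ^ (n+1) ≤ volume (dy (k, idx k x) ∩ A) := by
      obtain ⟨k, h1, h2⟩ := density_cubes hA hxd k0
      exact ⟨k, h1, h2⟩
    obtain ⟨hk, hkv⟩ := Nat.find_spec hex
    set k := Nat.find hex with hkdef
    rcases hk.eq_or_lt with he | hlt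
    · have hq : (k, idx k x) ∈ G := ⟨⟨he.symm, x, mem_dy_idx _ _, hxS⟩, hkv⟩
      exact interior_mono (biUnion_subset_biUnion_left subset_union_right)
        (hTG _ hq (mem_dy_idx _ _))
    · obtain ⟨j, hj⟩ : ∃ j, k = j + 1 := ⟨k - 1, by omega⟩
      have hmin := Nat.find_min hex (m := j) (by omega)
      have hk0j : k0 ≤ j := by omega
      have hup : volume (dy (j, idx j x) ∩ A) < 2⁻¹ * sd j ^ (n+1) := by
        by_contra hcon
        exact hmin ⟨hk0j, not_lt.1 hcon⟩
      have hlow : 2⁻¹ ^ (n+2) * sd j ^ (n+1) ≤ volume (dy (j, idx j x) ∩ A) := by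
        rw [hj] at hkv
        have hnest : dy (j+1, idx (j+1) x) ⊆ dy (j, idx j x) :=
          dy_nested (Nat.le_succ j) (mem_dy_idx j x) (mem_dy_idx (j+1) x)
        refine le_trans (le_of_eq ?_) (hkv.trans (measure_mono (inter_subset_inter_left _ hnest)))
        simp only [sd]
        ring
      have hq : (j, idx j x) ∈ R := ⟨hk0j, ⟨x, mem_dy_idx _ _, hxS⟩, hlow, hup.le⟩
      exact interior_mono (biUnion_subset_biUnion_left subset_union_left)
        (hFR _ hq (mem_dy_idx _ _))
  · rw [biUnion_union, union_sdiff_distrib]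
    refine (measure_union_le _ _).trans ?_
    have h1 : volume ((⋃ q ∈ F, dy q) \ A) ≤ sd k0 * (C2 * perimeter A V) :=
      (measure_mono sdiff_subset).trans ((volume_cubes_le F k0 hFk).trans (by gcongr))
    calc _ ≤ sd k0 * (C2 * perimeter A V) + (η / 2 + C1 * (sd k0 * perimeter A V)) :=
          add_le_add h1 hTv
      _ = η / 2 + sd k0 * (C1 * perimeter A V + C2 * perimeter A V) := by ring
      _ ≤ η / 2 + η / 2 := by gcongr
      _ = η := ENNReal.add_halves η
  · refine ne_top_of_le_ne_top ?_ (ENNReal.tsum_union_le (fun q : Cube (n+1) => sd q.1 ^ n) F T)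
    refine ENNReal.add_ne_top.2 ⟨ne_top_of_le_ne_top (ENNReal.mul_ne_top hC2 hP) hFs, ?_⟩
    have := hT.fintype
    rw [tsum_fintype]
    exact ENNReal.sum_ne_top.2 fun q _ => sdN_ne_top _ _

lemma exhaustion {Ω : Set (Euc N)} (hΩ : IsOpen Ω) : ∃ K : ℕ → Set (Euc N),
    K 0 = ∅ ∧ K 1 = ∅ ∧ (∀ m, IsCompact (K m)) ∧ (∀ m, K m ⊆ interior (K (m+1))) ∧
      ⋃ m, K m = Ω := by
  have := hΩ.locallyCompactSpace
  let c : CompactExhaustion Ω := CompactExhaustion.choice Ω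
  let K : ℕ → Set (Euc N) := fun m => match m with
    | 0 => ∅
    | 1 => ∅
    | m+2 => Subtype.val '' c m
  refine ⟨K, rfl, rfl, ?_, ?_, ?_⟩
  · rintro (_ | _ | m)
    · exact isCompact_empty
    · exact isCompact_empty
    · exact (c.isCompact m).image continuous_subtype_val
  · rintro (_ | _ | m)
    · exact empty_subset _
    · exact empty_subset _
    · exact (image_mono (c.subset_interior_succ m)).trans
        (hΩ.isOpenMap_subtype_val.image_interior_subset _)
  · apply Subset.antisymm
    · refine iUnion_subset ?_
      rintro (_ | _ | m)
      · exact empty_subset _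
      · exact empty_subset _
      · rintro _ ⟨x, -, rfl⟩
        exact x.2
    · intro x hx
      obtain ⟨m, hm⟩ := mem_iUnion.1 (c.iUnion_eq ▸ mem_univ (⟨x, hx⟩ : Ω))
      exact mem_iUnion.2 ⟨m+2, ⟨x, hx⟩, hm, rfl⟩

lemma main_succ {n : ℕ} (Ω : Set (Euc (n+1))) (hΩ : IsOpen Ω)
    (A : Set (Euc (n+1))) (hA : MeasurableSet A)
    (hper : HasLocFinPerimeter A Ω) (ε : ℝ) (hε : 0 < ε) :
    ∃ U : Set (Euc (n+1)), IsOpen U ∧ U ⊆ Ω ∧ HasLocFinPerimeter U Ω ∧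
      densityOne A Ω ⊆ U ∧ volume (U \ A) ≤ ENNReal.ofReal ε := by
  classical
  obtain ⟨K, hK0, hK1, hKc, hKi, hKu⟩ := exhaustion hΩ
  have hmono : Monotone K := monotone_nat_of_le_succ fun m => (hKi m).trans interior_subset
  have hKΩ : ∀ m, K m ⊆ Ω := fun m => hKu ▸ subset_iUnion K m
  obtain ⟨η, hη, hηs⟩ := ENNReal.exists_pos_sum_of_countable' (ENNReal.ofReal_pos.2 hε).ne' ℕ
  set V : ℕ → Set (Euc (n+1)) := fun m => interior (K (m+3)) \ K m with hVdef
  have hVK : ∀ m, V m ⊆ K (m+3) := fun m => sdiff_subset.trans interior_subset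
  have hVo : ∀ m, IsOpen (V m) := fun m => isOpen_interior.sdiff (hKc m).isClosed
  have hloc : ∀ m, ∃ F : Set (Cube (n+1)), (∀ q ∈ F, dy q ⊆ V m) ∧
      (∀ x ∈ K (m+2) \ interior (K (m+1)), HasDensity A x 1 → x ∈ interior (⋃ q ∈ F, dy q)) ∧
      volume ((⋃ q ∈ F, dy q) \ A) ≤ η m ∧ ∑' q : F, sd q.1.1 ^ n ≠ ⊤ := by
    intro m
    apply local_family hA ((hKc (m+2)).diff isOpen_interior) (hVo m)
    · exact sdiff_subset_sdiff (hKi _) (hKi _)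
    · have hcl : closure (V m) ⊆ K (m+3) := closure_minimal (hVK m) (hKc _).isClosed
      exact (hper (V m) (hVo m) ((hKc (m+3)).of_isClosed_subset isClosed_closure hcl)
        (hcl.trans (hKΩ _))).ne
    · exact (hη m).ne'
  choose F hFV hFd hFv hFs using hloc
  set FF : Set (Cube (n+1)) := ⋃ m, F m with hFF
  have hUeq : ⋃ q ∈ FF, dy q = ⋃ m, ⋃ q ∈ F m, dy q := by
    rw [hFF, biUnion_iUnion]
  refine ⟨interior (⋃ q ∈ FF, dy q), isOpen_interior, ?_, ?_, ?_, ?_⟩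
  · refine interior_subset.trans (iUnion₂_subset fun q hq => ?_)
    obtain ⟨m, hm⟩ := mem_iUnion.1 hq
    exact (hFV m q hm).trans ((hVK m).trans (hKΩ _))
  · intro Ω' hΩ' hc hcΩ
    obtain ⟨M, hM⟩ : ∃ M, closure Ω' ⊆ K M := by
      obtain ⟨M, hM⟩ := hc.elim_directed_cover (fun m => interior (K (m+1)))
        (fun _ => isOpen_interior)
        (hcΩ.trans (hKu ▸ iUnion_mono fun m => hKi m))
        (Monotone.directed_le fun a b hab => interior_mono (hmono (by omega)))
      exact ⟨M+1, hM.trans interior_subset⟩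
    have hsub : {q | q ∈ FF ∧ (dy q ∩ Ω').Nonempty} ⊆ ⋃ m ∈ Finset.range M, F m := by
      rintro q ⟨hq, x, hxq, hxΩ⟩
      obtain ⟨m, hm⟩ := mem_iUnion.1 hq
      have hlt : m < M := by
        by_contra hcon
        exact (hFV m q hm hxq).2 (hmono (not_lt.1 hcon) (hM (subset_closure hxΩ)))
      exact mem_biUnion (Finset.mem_coe.2 (Finset.mem_range.2 hlt)) hm
    refine (perimeter_cubes FF _ Ω' (interior_cubes_ae)).trans_lt ?_
    refine ENNReal.mul_lt_top ENNReal.ofReal_lt_top ?_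
    refine (ENNReal.tsum_mono_subtype (fun q : Cube (n+1) => sd q.1 ^ n) hsub).trans_lt ?_
    refine (ENNReal.tsum_biUnion_le (fun q : Cube (n+1) => sd q.1 ^ n) _ F).trans_lt ?_
    exact ENNReal.sum_lt_top.2 fun m _ => (hFs m).lt_top
  · rintro x ⟨hxΩ, hxd⟩
    have hex : ∃ m, x ∈ K m := mem_iUnion.1 (hKu.symm ▸ hxΩ)
    have hsp := Nat.find_spec hex
    obtain ⟨j, hj⟩ : ∃ j, Nat.find hex = j + 2 := by
      rcases hm : Nat.find hex with _ | _ | j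
      · rw [hm, hK0] at hsp; exact hsp.elim
      · rw [hm, hK1] at hsp; exact hsp.elim
      · exact ⟨j, rfl⟩
    have hmin := Nat.find_min hex (m := j + 1) (by omega)
    rw [hj] at hsp
    have := hFd j x ⟨hsp, fun h => hmin (interior_subset h)⟩ hxd
    exact interior_mono (biUnion_subset_biUnion_left (subset_iUnion F j)) this
  · refine (measure_mono (sdiff_subset_sdiff_left interior_subset)).trans ?_
    rw [hUeq, iUnion_sdiff]
    exact (measure_iUnion_le _).trans ((ENNReal.tsum_le_tsum hFv).trans hηs.le)

lemma hasDensity_congr {A B : Set (Euc N)} (h : A =ᵐ[volume] B) {x : Euc N} {t : ℝ}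
    (hA : HasDensity A x t) : HasDensity B x t := by
  refine hA.congr fun ρ => ?_
  rw [measure_congr (h.inter (ae_eq_refl (ball x ρ)))]

lemma main_zero (Ω : Set (Euc 0)) (A : Set (Euc 0)) (hA : A ⊆ Ω)
    (hper : HasLocFinPerimeter A Ω) (ε : ℝ) :
    ∃ U : Set (Euc 0), IsOpen U ∧ U ⊆ Ω ∧ HasLocFinPerimeter U Ω ∧
      densityOne A Ω ⊆ U ∧ volume (U \ A) ≤ ENNReal.ofReal ε := by
  refine ⟨A, isOpen_discrete A, hA, hper, ?_, by simp⟩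
  rintro x ⟨-, hx⟩
  by_contra hxA
  have : A = ∅ := by
    ext y
    rw [Subsingleton.elim y x]
    simp [hxA]
  subst this
  have h : Tendsto (fun _ : ℝ => (0 : ℝ≥0∞)) (𝓝[>] 0) (𝓝 (ENNReal.ofReal 1)) := by
    simpa [HasDensity] using hx
  have := tendsto_nhds_unique h tendsto_const_nhds
  simp at this

/-- if `A ⊆ Ω` is a measurable set with locally finite perimeter in the open
set `Ω`, then for every `ε > 0` there is an open `U ⊆ Ω` with locally finite perimeter in
`Ω` such that `A^{(1)} ⊆ U` and `λ^N(U \ A) ≤ ε`. -/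
theorem statement17 {N : ℕ} (Ω : Set (Euc N)) (hΩ : IsOpen Ω)
    (A : Set (Euc N)) (hA : A ⊆ Ω) (hmA : NullMeasurableSet A volume)
    (hper : HasLocFinPerimeter A Ω) (ε : ℝ) (hε : 0 < ε) :
    ∃ U : Set (Euc N), IsOpen U ∧ U ⊆ Ω ∧ HasLocFinPerimeter U Ω ∧
      densityOne A Ω ⊆ U ∧ volume (U \ A) ≤ ENNReal.ofReal ε := by

  rcases N with _ | n
  · exact main_zero Ω A hA hper ε
  obtain ⟨B, -, hB, hBA⟩ := hmA.exists_measurable_superset_ae_eq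
  obtain ⟨U, hU, hUΩ, hUp, hUd, hUv⟩ := main_succ Ω hΩ B hB
    (fun Ω' h1 h2 h3 => by rw [perimeter_congr hBA]; exact hper Ω' h1 h2 h3) ε hε
  refine ⟨U, hU, hUΩ, hUp, ?_, ?_⟩
  · rintro x ⟨hx, hd⟩
    exact hUd ⟨hx, hasDensity_congr hBA.symm hd⟩
  · rwa [measure_congr ((ae_eq_refl U).diff hBA)] at hUv
end
end

section
/- For every N ≥ 2 there exists a set C ⊆ ℝ^N which is GBV-polar in Ω := ℝ^N but satisfies H^{N-1}(C) > 0; consequently C is GBV-polar but not BV-polar, so the inclusion of BV-polar sets into GBV-polar sets is strict. -/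
open MeasureTheory Metric Filter Set
open scoped ENNReal Topology symmDiff

noncomputable section

variable {N : ℕ}

lemma dual_aux {E : Type*} [NormedAddCommGroup E] [NormedSpace ℝ E] [FiniteDimensional ℝ E]
    [MeasurableSpace E] [BorelSpace E] (μ : Measure E) [IsFiniteMeasureOnCompacts μ]
    (v : E → ℝ) (hv : Integrable v μ) (A : ℝ)
    (h : ∀ ψ : E → ℝ, ContDiff ℝ 1 ψ → HasCompactSupport ψ → (∀ x, |ψ x| ≤ 1) →
      ∫ x, v x * ψ x ∂μ ≤ A) : ∫ x, |v x| ∂μ ≤ A := by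
  refine le_of_forall_pos_le_add fun ε hε => ?_
  obtain ⟨w, hwc, hws, hw⟩ := MeasureTheory.MemLp.exist_eLpNorm_sub_le (p := 1) (by simp) le_rfl
    (memLp_one_iff_integrable.2 hv) (ε := ε / 4) (by positivity)
  have hwi : Integrable w μ := hws.continuous.integrable_of_hasCompactSupport hwc
  have hvw : ∫ x, |v x - w x| ∂μ ≤ ε / 4 := by
    rw [eLpNorm_one_eq_lintegral_enorm] at hw
    have := integral_norm_eq_lintegral_enorm (hv.sub hwi).aestronglyMeasurable
    have h2 : ∫ x, |v x - w x| ∂μ = (∫⁻ x, ‖(v - w) x‖ₑ ∂μ).toReal := by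
      rw [← this]; rfl
    rw [h2]
    exact ENNReal.toReal_le_of_le_ofReal (by positivity) hw
  set M : ℝ := μ.real (tsupport w) with hM
  have hM0 : 0 ≤ M := measureReal_nonneg
  set δ : ℝ := ε / (2 * (M + 1)) with hδ
  have hδ0 : 0 < δ := by positivity
  have hpos : ∀ x, 0 < w x ^ 2 + δ ^ 2 := fun x => by positivity
  set ψ : E → ℝ := fun x => w x / Real.sqrt (w x ^ 2 + δ ^ 2) with hψ
  have hs : ∀ x, 0 < Real.sqrt (w x ^ 2 + δ ^ 2) := fun x => Real.sqrt_pos.2 (hpos x)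
  have habs : ∀ x, |w x| ≤ Real.sqrt (w x ^ 2 + δ ^ 2) := fun x =>
    Real.abs_le_sqrt (by nlinarith [sq_nonneg δ])
  have hψ1 : ∀ x, |ψ x| ≤ 1 := fun x => by
    simp only [hψ]
    rw [abs_div, abs_of_pos (hs x), div_le_one (hs x)]
    exact habs x
  have hψs : ContDiff ℝ 1 ψ := by
    have hw1 : ContDiff ℝ 1 w := hws.of_le (by exact_mod_cast le_top)
    exact hw1.div (((hw1.pow 2).add contDiff_const).sqrt fun x => (hpos x).ne') fun x => (hs x).ne'
  have hψc : HasCompactSupport ψ := by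
    refine hwc.mono fun x hx => ?_
    simp only [Function.mem_support, hψ] at hx ⊢
    intro h0; apply hx; simp [h0]
  have hA := h ψ hψs hψc hψ1
  have hvψ : Integrable (fun x => v x * ψ x) μ := by
    refine hv.mul_bdd (c := 1) hψs.continuous.aestronglyMeasurable (ae_of_all _ fun x => ?_)
    simpa using hψ1 x
  have hpt : ∀ x, |v x| ≤ v x * ψ x + 2 * |v x - w x| + (tsupport w).indicator (fun _ => δ) x := by
    intro x
    have h1 : |w x| - w x * ψ x ≤ (tsupport w).indicator (fun _ => δ) x := by
      by_cases hx : x ∈ tsupport w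
      · rw [indicator_of_mem hx]
        simp only [hψ]
        rw [mul_div_assoc', sub_le_iff_le_add, ← sub_le_iff_le_add', le_div_iff₀ (hs x)]
        have h3 : Real.sqrt (w x ^ 2 + δ ^ 2) ≤ |w x| + δ := by
          rw [Real.sqrt_le_left (by positivity)]
          nlinarith [abs_nonneg (w x), sq_abs (w x), mul_nonneg (abs_nonneg (w x)) hδ0.le]
        by_cases h4 : |w x| - δ ≤ 0
        · nlinarith [hs x, sq_nonneg (w x)]
        · nlinarith [hs x, sq_abs (w x)]
      · rw [indicator_of_notMem hx]
        have : w x = 0 := image_eq_zero_of_notMem_tsupport hx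
        simp [this]
    have h2 : |v x| ≤ |w x| + |v x - w x| := by
      have := abs_add_le (w x) (v x - w x); simpa using this
    have h3 : (w x - v x) * ψ x ≤ |v x - w x| := by
      calc _ ≤ |(w x - v x) * ψ x| := le_abs_self _
        _ = |v x - w x| * |ψ x| := by rw [abs_mul, abs_sub_comm]
        _ ≤ |v x - w x| * 1 := by gcongr; exact hψ1 x
        _ = _ := mul_one _
    nlinarith
  have hind : Integrable ((tsupport w).indicator (fun _ => δ)) μ :=
    (integrable_indicator_iff (isClosed_tsupport w).measurableSet).2
      (integrableOn_const hwc.isCompact.measure_lt_top.ne)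
  have hsub : Integrable (fun x => 2 * |v x - w x|) μ := ((hv.sub hwi).abs).const_mul 2
  have hsum : Integrable (fun x => v x * ψ x + 2 * |v x - w x|) μ := hvψ.add hsub
  have := integral_mono hv.abs (hsum.add hind) hpt
  simp only [Pi.add_apply] at this
  rw [integral_add hsum hind, integral_add hvψ hsub, integral_const_mul,
    integral_indicator_const _ (isClosed_tsupport w).measurableSet] at this
  have h5 : M * δ ≤ ε / 2 := by
    rw [hδ, mul_div_assoc', div_le_div_iff₀ (by positivity) (by positivity)]
    nlinarith
  simp only [smul_eq_mul, ← hM] at this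
  linarith

lemma prim_aux {E : Type*} [NormedAddCommGroup E] [NormedSpace ℝ E] 
    (ψ : E → ℝ) (hψ : ContDiff ℝ 1 ψ) (hc : HasCompactSupport ψ) (e : E) :
    ContDiff ℝ 1 (fun x => ∫ τ in (0:ℝ)..1, (1 - τ) * ψ (x - τ • e)) ∧
    HasCompactSupport (fun x => ∫ τ in (0:ℝ)..1, (1 - τ) * ψ (x - τ • e)) ∧
    ∀ x, fderiv ℝ (fun x => ∫ τ in (0:ℝ)..1, (1 - τ) * ψ (x - τ • e)) x e
      = ψ x - ∫ τ in (0:ℝ)..1, ψ (x - τ • e) := by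
  have hψc : Continuous ψ := hψ.continuous
  have hdc : Continuous (fderiv ℝ ψ) := hψ.continuous_fderiv (by norm_num)
  have hdiff : Differentiable ℝ ψ := hψ.differentiable (by norm_num)
  obtain ⟨B, hB⟩ := (hc.fderiv (𝕜 := ℝ)).exists_bound_of_continuous hdc
  have hder : ∀ x, HasFDerivAt (fun x => ∫ τ in (0:ℝ)..1, (1 - τ) * ψ (x - τ • e))
      (∫ τ in (0:ℝ)..1, (1 - τ) • fderiv ℝ ψ (x - τ • e)) x := by
    intro x
    refine intervalIntegral.hasFDerivAt_integral_of_dominated_of_fderiv_le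
      (F' := fun x τ => (1 - τ) • fderiv ℝ ψ (x - τ • e)) (bound := fun _ => B)
      (s := Set.univ) univ_mem ?_ ?_ ?_ ?_ ?_ ?_
    · refine Eventually.of_forall fun y => Continuous.aestronglyMeasurable (by fun_prop)
    · exact Continuous.intervalIntegrable (by fun_prop) _ _
    · exact Continuous.aestronglyMeasurable (by fun_prop)
    · refine ae_of_all _ fun t ht y _ => ?_
      rw [uIoc_of_le zero_le_one] at ht
      rw [norm_smul, Real.norm_eq_abs]
      calc |1 - t| * ‖fderiv ℝ ψ (y - t • e)‖ ≤ 1 * B := by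
            gcongr
            · rw [abs_le]; constructor <;> linarith [ht.1, ht.2]
            · exact hB _
        _ = B := one_mul _
    · exact intervalIntegrable_const
    · refine ae_of_all _ fun t _ y _ => ?_
      have h1 : HasFDerivAt (fun y => ψ (y - t • e)) (fderiv ℝ ψ (y - t • e)) y := by
        have := (hdiff (y - t • e)).hasFDerivAt.comp y ((hasFDerivAt_id y).sub_const (t • e))
        simpa [Function.comp_def] using this
      exact h1.const_mul (1 - t)
  refine ⟨?_, ?_, ?_⟩
  · rw [contDiff_one_iff_fderiv]
    refine ⟨fun x => (hder x).differentiableAt, ?_⟩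
    have : fderiv ℝ (fun x => ∫ τ in (0:ℝ)..1, (1 - τ) * ψ (x - τ • e)) =
      fun x => ∫ τ in (0:ℝ)..1, (1 - τ) • fderiv ℝ ψ (x - τ • e) := funext fun x => (hder x).fderiv
    rw [this]
    exact intervalIntegral.continuous_parametric_intervalIntegral_of_continuous' (by fun_prop) _ _
  · have hK : IsCompact ((fun p : E × ℝ => p.1 + p.2 • e) '' (tsupport ψ ×ˢ Icc (0:ℝ) 1)) :=
      (hc.isCompact.prod isCompact_Icc).image (by fun_prop)
    refine HasCompactSupport.intro hK fun x hx => ?_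
    rw [intervalIntegral.integral_congr (g := fun _ => (0:ℝ))]
    · simp
    · intro t ht
      rw [uIcc_of_le zero_le_one] at ht
      have : ψ (x - t • e) = 0 := by
        refine image_eq_zero_of_notMem_tsupport fun hm => hx ⟨(x - t • e, t), ⟨hm, ht⟩, ?_⟩
        simp
      simp [this]
  · intro x
    rw [(hder x).fderiv]
    have h1 : (∫ τ in (0:ℝ)..1, (1 - τ) • fderiv ℝ ψ (x - τ • e)) e
        = ∫ τ in (0:ℝ)..1, (1 - τ) * fderiv ℝ ψ (x - τ • e) e := by
      rw [ContinuousLinearMap.intervalIntegral_apply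
        (Continuous.intervalIntegrable (by fun_prop) _ _)]
      simp
    rw [h1]
    have h2 : ∀ t : ℝ, HasDerivAt (fun t : ℝ => (1 - t) * ψ (x - t • e))
        (- ψ (x - t • e) - (1 - t) * fderiv ℝ ψ (x - t • e) e) t := by
      intro t
      have h3 : HasDerivAt (fun t : ℝ => x - t • e) (-e) t := by
        simpa using ((hasDerivAt_id t).smul_const e).const_sub x
      have h4 := (hdiff (x - t • e)).hasFDerivAt.comp_hasDerivAt t h3
      have h5 : HasDerivAt (fun t : ℝ => 1 - t) (-1) t := by
        simpa using (hasDerivAt_id t).const_sub 1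
      have := h5.mul h4
      refine HasDerivAt.congr_deriv this ?_
      rw [map_neg]; simp only [Function.comp_apply]; ring
    have h6 := intervalIntegral.integral_eq_sub_of_hasDerivAt (a := 0) (b := 1) (fun t _ => h2 t)
      (Continuous.intervalIntegrable (by fun_prop) _ _)
    rw [intervalIntegral.integral_sub (Continuous.intervalIntegrable (by fun_prop) _ _)
      (Continuous.intervalIntegrable (by fun_prop) _ _), intervalIntegral.integral_neg] at h6
    simp at h6
    linarith

lemma strip_bound (g : ℝ → ℝ) (a r : ℝ) (hr : 0 < r) (hb : ∀ t ∈ Ioc (0:ℝ) 1, |g t| ≤ 1)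
    (h0 : ∀ t, r < |a - t| → g t = 0) : |∫ t in (0:ℝ)..1, g t| ≤ 2 * r := by
  have h1 : ‖∫ t in (0:ℝ)..1, g t‖ ≤
      ∫ t in (0:ℝ)..1, (Icc (a - r) (a + r)).indicator (fun _ => (1:ℝ)) t := by
    refine intervalIntegral.norm_integral_le_of_norm_le zero_le_one (ae_of_all _ fun t ht => ?_) ?_
    · by_cases h : t ∈ Icc (a - r) (a + r)
      · rw [indicator_of_mem h]; exact hb t ht
      · rw [h0 t]
        · simp [indicator_nonneg]
        · rw [lt_abs]
          by_contra hh
          push Not at hh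
          exact h ⟨by linarith [hh.1], by linarith [hh.2]⟩
    · rw [intervalIntegrable_iff]
      exact ((integrable_indicator_iff measurableSet_Icc).2
        (integrableOn_const (by simp))).integrableOn
  refine h1.trans ?_
  rw [intervalIntegral.integral_of_le zero_le_one]
  calc _ ≤ ∫ t, (Icc (a - r) (a + r)).indicator (fun _ => (1:ℝ)) t := by
        refine setIntegral_le_integral ?_ (ae_of_all _ fun t => ?_)
        · exact (integrable_indicator_iff measurableSet_Icc).2 (integrableOn_const (by simp))
        · exact indicator_nonneg (fun _ _ => zero_le_one) t
    _ = 2 * r := by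
        rw [integral_indicator_const _ measurableSet_Icc]
        simp only [Real.volume_real_Icc, smul_eq_mul, mul_one]
        rw [max_eq_left (by linarith)]; ring

lemma slab_bound {n : ℕ} (u : Euc (n+1) → ℝ) (hu : MemBV u Set.univ) (ρ : ℝ) (hρ : 0 < ρ) :
    ∫ x in {x : Euc (n+1) | |x 0| < ρ}, |u x| ≤
      4 * ρ * ((variation u Set.univ).toReal + ∫ x, |u x|) := by
  obtain ⟨hui, huV⟩ := hu
  rw [integrableOn_univ] at hui
  set e : Euc (n+1) := EuclideanSpace.single 0 1 with he
  have hne : ‖e‖ = 1 := by simp [he]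
  have he0 : ∀ (x : Euc (n+1)) (τ : ℝ), (x - τ • e) 0 = x 0 - τ := by
    intro x τ; simp [he]
  let χ : ContDiffBump (0:ℝ) := ⟨ρ, 2 * ρ, hρ, by linarith⟩
  have hχs : ContDiff ℝ 1 (fun x : Euc (n+1) => χ (x 0)) :=
    χ.contDiff.comp (by fun_prop)
  set v : Euc (n+1) → ℝ := fun x => u x * χ (x 0) with hv
  have hvi : Integrable v := by
    refine hui.mul_bdd (c := 1) hχs.continuous.aestronglyMeasurable (ae_of_all _ fun x => ?_)
    rw [Real.norm_eq_abs, abs_of_nonneg χ.nonneg]; exact χ.le_one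
  have hsm : MeasurableSet {x : Euc (n+1) | |x 0| < ρ} :=
    (isOpen_lt (by fun_prop) continuous_const).measurableSet
  have h1 : ∫ x in {x : Euc (n+1) | |x 0| < ρ}, |u x| ≤ ∫ x, |v x| := by
    rw [← integral_indicator hsm]
    refine integral_mono (hui.abs.indicator hsm) hvi.abs fun x => ?_
    by_cases hx : x ∈ {x : Euc (n+1) | |x 0| < ρ}
    · rw [indicator_of_mem hx]
      have : χ (x 0) = 1 := χ.one_of_mem_closedBall (by
        simp only [mem_closedBall, dist_zero_right, Real.norm_eq_abs]; exact le_of_lt hx)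
      simp [hv, this]
    · rw [indicator_of_notMem hx]; exact abs_nonneg _
  refine h1.trans (dual_aux volume v hvi _ ?_)
  intro ψ₀ hψ₀s hψ₀c hψ₀1
  set ψ : Euc (n+1) → ℝ := fun x => χ (x 0) * ψ₀ x with hψ
  have hψs : ContDiff ℝ 1 ψ := hχs.mul hψ₀s
  have hψc : HasCompactSupport ψ := hψ₀c.mul_left
  have hψ1 : ∀ x, |ψ x| ≤ 1 := fun x => by
    simp only [hψ]
    rw [abs_mul, abs_of_nonneg χ.nonneg]
    exact mul_le_one₀ χ.le_one (abs_nonneg _) (hψ₀1 x)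
  have hψ0 : ∀ x : Euc (n+1), 2 * ρ < |x 0| → ψ x = 0 := fun x hx => by
    have : χ (x 0) = 0 := χ.zero_of_le_dist (by
      simp only [dist_zero_right, Real.norm_eq_abs]; exact le_of_lt hx)
    simp [hψ, this]
  obtain ⟨hΦs, hΦc, hΦd⟩ := prim_aux ψ hψs hψc e
  set Φ : Euc (n+1) → ℝ := fun x => ∫ τ in (0:ℝ)..1, (1 - τ) * ψ (x - τ • e) with hΦ
  set G : Euc (n+1) → ℝ := fun x => ∫ τ in (0:ℝ)..1, ψ (x - τ • e) with hG
  have hΦb : ∀ x, |Φ x| ≤ 4 * ρ := fun x => by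
    have := strip_bound (fun τ => (1 - τ) * ψ (x - τ • e)) (x 0) (2 * ρ) (by linarith) ?_ ?_
    · refine this.trans (by linarith)
    · intro t ht
      rw [abs_mul]
      refine mul_le_one₀ ?_ (abs_nonneg _) (hψ1 _)
      rw [abs_le]; constructor <;> linarith [ht.1, ht.2]
    · intro t ht
      simp [hψ0 (x - t • e) (by rw [he0]; exact ht)]
  have hGb : ∀ x, |G x| ≤ 4 * ρ := fun x => by
    have := strip_bound (fun τ => ψ (x - τ • e)) (x 0) (2 * ρ) (by linarith) ?_ ?_
    · refine this.trans (by linarith)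
    · intro t ht
      exact hψ1 _
    · intro t ht
      simp [hψ0 (x - t • e) (by rw [he0]; exact ht)]
  have hGc : Continuous G := by
    have hψc := hψs.continuous
    exact intervalIntegral.continuous_parametric_intervalIntegral_of_continuous' (by fun_prop) _ _
  -- the test field
  set φ : Euc (n+1) → Euc (n+1) := fun x => ((4 * ρ)⁻¹ * Φ x) • e with hφ
  have hφt : φ ∈ TestVF (Set.univ : Set (Euc (n+1))) := by
    refine ⟨(contDiff_const.mul hΦs).smul contDiff_const, ?_, subset_univ _, fun x => ?_⟩
    · refine hΦc.mono fun x hx => ?_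
      simp only [Function.mem_support, hφ] at hx ⊢
      intro h0; apply hx; simp [h0]
    · simp only [hφ]
      rw [norm_smul, hne, mul_one, norm_mul, norm_inv,
        Real.norm_eq_abs, Real.norm_eq_abs, abs_of_pos (by positivity : 0 < 4 * ρ),
        inv_mul_le_one₀ (by positivity)]
      exact hΦb x
  have hdiv : ∀ x, diverg φ x = (4 * ρ)⁻¹ * (ψ x - G x) := by
    intro x
    have hd : HasFDerivAt φ (((4 * ρ)⁻¹ • fderiv ℝ Φ x).smulRight e) x :=
      (((hΦs.differentiable (by norm_num)) x).hasFDerivAt.const_mul _).smul_const e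
    unfold diverg
    rw [hd.fderiv, Finset.sum_eq_single 0]
    · rw [← hΦd x]; simp [he]
    · intro i _ hi
      simp [he, hi]
    · simp
  have hle : ENNReal.ofReal (∫ x in Set.univ, u x * diverg φ x) ≤ variation u Set.univ :=
    le_iSup₂_of_le φ hφt le_rfl
  rw [ENNReal.ofReal_le_iff_le_toReal huV.ne, setIntegral_univ] at hle
  simp only [hdiv] at hle
  have hi1 : Integrable (fun x => u x * ψ x) := by
    refine hui.mul_bdd (c := 1) hψs.continuous.aestronglyMeasurable (ae_of_all _ fun x => ?_)
    exact hψ1 x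
  have hi2 : Integrable (fun x => u x * G x) := by
    refine hui.mul_bdd (c := 4 * ρ) hGc.aestronglyMeasurable (ae_of_all _ fun x => ?_)
    exact hGb x
  have h3 : ∫ x, u x * ((4 * ρ)⁻¹ * (ψ x - G x)) =
      (4 * ρ)⁻¹ * (∫ x, u x * ψ x) - (4 * ρ)⁻¹ * ∫ x, u x * G x := by
    rw [← mul_sub, ← integral_sub hi1 hi2, ← integral_const_mul]
    congr 1; ext x; ring
  have h4 : ∫ x, u x * G x ≤ 4 * ρ * ∫ x, |u x| := by
    rw [← integral_const_mul]
    refine integral_mono hi2 (hui.abs.const_mul _) fun x => ?_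
    calc u x * G x ≤ |u x * G x| := le_abs_self _
      _ = |G x| * |u x| := by rw [abs_mul, mul_comm]
      _ ≤ _ := by gcongr; exact hGb x
  have h5 : ∫ x, v x * ψ₀ x = ∫ x, u x * ψ x := by
    congr 1; ext x; simp only [hv, hψ]; ring
  rw [h5]
  rw [h3, ← mul_sub, inv_mul_le_iff₀ (by positivity)] at hle
  linarith

lemma HasDensity.zero_mono {A B : Set (Euc N)} {x : Euc N} (h : HasDensity B x 0) (hAB : A ⊆ B) :
    HasDensity A x 0 := by
  unfold HasDensity at *
  rw [ENNReal.ofReal_zero] at *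
  refine tendsto_of_tendsto_of_tendsto_of_le_of_le tendsto_const_nhds h (fun _ => zero_le) ?_
  intro ρ
  dsimp only
  gcongr

lemma density_of_inf {u : Euc N → ℝ} {x : Euc N} (h : HasInfApproxLimit u Set.univ x) (s : ℝ) :
    HasDensity {y | |u y| < s} x 0 := by
  rcases h with ⟨-, h⟩ | ⟨h, -⟩
  · unfold approxLower at h
    obtain ⟨_, ⟨t, rfl, ht⟩, hst⟩ := (sSup_eq_top.1 h) (s : EReal) (EReal.coe_lt_top s)
    refine ht.zero_mono fun y hy => ⟨mem_univ _, ?_⟩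
    exact ((le_abs_self _).trans_lt hy).trans (EReal.coe_lt_coe_iff.1 hst)
  · unfold approxUpper at h
    obtain ⟨_, ⟨t, rfl, ht⟩, hst⟩ := (sInf_eq_bot.1 h) ((-s : ℝ) : EReal) (EReal.bot_lt_coe _)
    refine ht.zero_mono fun y hy => ⟨mem_univ _, ?_⟩
    exact (EReal.coe_lt_coe_iff.1 hst).trans (abs_lt.1 hy).1

lemma avg_top {u : Euc N → ℝ} (hu : AEMeasurable u) {p : Euc N}
    (h : HasInfApproxLimit u Set.univ p) :
    Tendsto (fun ρ : ℝ => (∫⁻ y in ball p ρ, ‖u y‖ₑ) / volume (ball p ρ)) (𝓝[>] 0) (𝓝 ⊤) := by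
  refine ENNReal.tendsto_nhds_top fun k => ?_
  have hd := density_of_inf h (2 * (k + 1))
  unfold HasDensity at hd
  rw [ENNReal.ofReal_zero] at hd
  have h2 : (0 : ℝ≥0∞) < 2⁻¹ := by simp
  filter_upwards [hd.eventually_lt_const h2, self_mem_nhdsWithin] with ρ hρ hρ0
  have hB0 : volume (ball p ρ) ≠ 0 := (measure_ball_pos _ _ hρ0).ne'
  have hBt : volume (ball p ρ) ≠ ⊤ := measure_ball_lt_top.ne
  rw [ENNReal.div_lt_iff (Or.inl hB0) (Or.inl hBt)] at hρ
  rw [ENNReal.lt_div_iff_mul_lt (Or.inl hB0) (Or.inl hBt)]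
  set S : Set (Euc N) := {y | |u y| < 2 * (k + 1)}
  set ε : ℝ≥0∞ := ENNReal.ofReal (2 * (k + 1)) with hε
  have hm := mul_meas_ge_le_lintegral₀ (μ := volume.restrict (ball p ρ)) (f := fun y => ‖u y‖ₑ)
    hu.enorm.restrict ε
  rw [Measure.restrict_apply' measurableSet_ball] at hm
  have hcov : volume (ball p ρ) ≤ volume (S ∩ ball p ρ) + volume ({y | ε ≤ ‖u y‖ₑ} ∩ ball p ρ) := by
    refine (measure_mono fun y hy => ?_).trans (measure_union_le _ _)
    by_cases hs : |u y| < 2 * (k + 1)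
    · exact Or.inl ⟨hs, hy⟩
    · refine Or.inr ⟨?_, hy⟩
      change ε ≤ ‖u y‖ₑ
      rw [hε, Real.enorm_eq_ofReal_abs]
      exact ENNReal.ofReal_le_ofReal (not_lt.1 hs)
  set b := volume (ball p ρ)
  set c := volume ({y | ε ≤ ‖u y‖ₑ} ∩ ball p ρ)
  have hc : 2⁻¹ * b ≤ c := by
    have h3 : 2⁻¹ * b + 2⁻¹ * b ≤ 2⁻¹ * b + c := by
      rw [← add_mul, ENNReal.inv_two_add_inv_two, one_mul]
      exact hcov.trans (by gcongr)
    exact (ENNReal.add_le_add_iff_left (by finiteness)).1 h3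
  have hε2 : ε * 2⁻¹ = (k : ℝ≥0∞) + 1 := by
    rw [hε, ENNReal.ofReal_mul (by norm_num), ENNReal.ofReal_add (by positivity) (by norm_num)]
    simp only [ENNReal.ofReal_natCast, ENNReal.ofReal_one, ENNReal.ofReal_ofNat]
    rw [mul_comm, ← mul_assoc, ENNReal.inv_mul_cancel (by simp) (by simp), one_mul]
  calc (k : ℝ≥0∞) * b < (k + 1) * b := by
        rw [ENNReal.mul_lt_mul_iff_left hB0 hBt]
        exact_mod_cast Nat.lt_succ_self k
    _ = ε * (2⁻¹ * b) := by rw [← hε2, mul_assoc]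
    _ ≤ ε * c := by gcongr
    _ ≤ _ := hm

lemma box_bound {n : ℕ} (y : Euc (n+1)) (ρ : ℝ) :
    volume {x : Euc (n+1) | |x 0| < 1 ∧ dist y (x - x 0 • EuclideanSpace.single 0 1) < ρ} ≤
      ENNReal.ofReal 2 * ENNReal.ofReal (2 * ρ) ^ n := by
  set T : Fin (n+1) → Set ℝ :=
    Fin.cons (Ioo (-1) 1) (fun i : Fin n => Ioo (y i.succ - ρ) (y i.succ + ρ)) with hT
  have hTm : MeasurableSet (Set.univ.pi T) := by
    refine MeasurableSet.univ_pi fun i => ?_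
    refine Fin.cases ?_ (fun i => ?_) i
    · simp [hT]
    · simp [hT]
  have hsub : {x : Euc (n+1) | |x 0| < 1 ∧ dist y (x - x 0 • EuclideanSpace.single 0 1) < ρ} ⊆
      (@WithLp.ofLp 2 (Fin (n+1) → ℝ)) ⁻¹' (Set.univ.pi T) := by
    rintro x ⟨h1, h2⟩
    simp only [mem_preimage, mem_univ_pi]
    intro i
    refine Fin.cases ?_ (fun i => ?_) i
    · simp only [hT, Fin.cons_zero]
      exact abs_lt.1 h1
    · simp only [hT, Fin.cons_succ]
      have h3 : |y i.succ - x i.succ| < ρ := by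
        refine lt_of_le_of_lt ?_ h2
        rw [dist_eq_norm]
        have := PiLp.norm_apply_le (y - (x - x 0 • EuclideanSpace.single 0 1)) i.succ
        simpa using this
      rw [abs_lt] at h3
      exact ⟨by linarith [h3.2], by linarith [h3.1]⟩
  refine (measure_mono hsub).trans ?_
  rw [(PiLp.volume_preserving_ofLp (Fin (n+1))).measure_preimage hTm.nullMeasurableSet,
    volume_pi_pi, Fin.prod_univ_succ]
  simp only [hT, Fin.cons_zero, Fin.cons_succ, Real.volume_Ioo]
  refine le_of_eq ?_
  congr 1
  · norm_num
  · simp only [add_sub_sub_cancel, ← two_mul, Finset.prod_const, Finset.card_univ, Fintype.card_fin]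

lemma not_bvpolar {n : ℕ} : ¬ BVPolar {x : Euc (n+1) | x 0 = 0} Set.univ := by
  rintro ⟨u, hu, hC⟩
  have hui : Integrable u := integrableOn_univ.1 hu.1
  have hslab := slab_bound u hu
  set A : ℝ := (variation u Set.univ).toReal + ∫ x, |u x| with hA
  have hA0 : 0 ≤ A := add_nonneg ENNReal.toReal_nonneg (integral_nonneg fun _ => abs_nonneg _)
  obtain ⟨f, hf, hfu⟩ := hui.aemeasurable.enorm
  set e : Euc (n+1) := EuclideanSpace.single 0 1 with he
  have hπ : Continuous (fun x : Euc (n+1) => x - x 0 • e) := by fun_prop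
  set P : Euc (n+1) → Euc (n+1) := fun x => x - x 0 • e with hP
  have hP0 : ∀ x, P x 0 = 0 := fun x => by simp [hP, he]
  let W : ℝ → Set (Euc (n+1) × Euc (n+1)) := fun ρ => {q | dist q.2 (P q.1) < ρ}
  have hW : ∀ ρ, MeasurableSet (W ρ) := fun ρ =>
    (isOpen_lt (by fun_prop) continuous_const).measurableSet
  let F : ℝ → Euc (n+1) × Euc (n+1) → ℝ≥0∞ := fun ρ => (W ρ).indicator (fun q => f q.2)
  have hF : ∀ ρ, Measurable (F ρ) := fun ρ => (hf.comp measurable_snd).indicator (hW ρ)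
  set K : Set (Euc (n+1)) := ball 0 1 with hK
  have hKb : ∀ x ∈ K, |x 0| < 1 := fun x hx => by
    have h1 := PiLp.norm_apply_le x 0
    rw [hK, mem_ball_zero_iff] at hx
    exact h1.trans_lt hx
  -- averages
  have hFavg : ∀ ρ x, ∫⁻ y, F ρ (x, y) = ∫⁻ y in ball (P x) ρ, ‖u y‖ₑ := by
    intro ρ x
    rw [← lintegral_indicator measurableSet_ball]
    refine lintegral_congr_ae ?_
    filter_upwards [hfu] with y hy
    by_cases h : dist y (P x) < ρ
    · have h1 : (x, y) ∈ W ρ := h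
      have h2 : y ∈ ball (P x) ρ := h
      simp only [F, indicator_of_mem h1, indicator_of_mem h2, hy]
    · have h1 : (x, y) ∉ W ρ := h
      have h2 : y ∉ ball (P x) ρ := h
      simp only [F, indicator_of_notMem h1, indicator_of_notMem h2]
  have hslabf : ∀ ρ > 0, ∫⁻ y in {y : Euc (n+1) | |y 0| < ρ}, f y ≤ ENNReal.ofReal (4 * ρ * A) := by
    intro ρ hρ
    rw [← lintegral_congr_ae (ae_restrict_of_ae hfu),
      ← ofReal_integral_norm_eq_lintegral_enorm hui.integrableOn]
    exact ENNReal.ofReal_le_ofReal (hslab ρ hρ)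
  have hsm : ∀ ρ, MeasurableSet {x : Euc (n+1) | |x 0| < ρ} := fun ρ =>
    (isOpen_lt (by fun_prop) continuous_const).measurableSet
  have hupper : ∀ ρ > 0, ∫⁻ x in K, ∫⁻ y, F ρ (x, y) ≤
      ENNReal.ofReal (4 * ρ * A) * (ENNReal.ofReal 2 * ENNReal.ofReal (2 * ρ) ^ n) := by
    intro ρ hρ
    rw [lintegral_lintegral_swap (f := fun x y => F ρ (x, y)) (hF ρ).aemeasurable]
    have hpt : ∀ y, ∫⁻ x in K, F ρ (x, y) ≤
        {y : Euc (n+1) | |y 0| < ρ}.indicator f y *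
          (ENNReal.ofReal 2 * ENNReal.ofReal (2 * ρ) ^ n) := by
      intro y
      by_cases hy : |y 0| < ρ
      · rw [indicator_of_mem (show y ∈ {y : Euc (n+1) | |y 0| < ρ} from hy)]
        have hV : MeasurableSet {x | dist y (P x) < ρ} :=
          (isOpen_lt (by fun_prop) continuous_const).measurableSet
        have h1 : ∀ x, F ρ (x, y) = {x | dist y (P x) < ρ}.indicator (fun _ => f y) x := fun x => rfl
        simp only [h1]
        rw [lintegral_indicator_const hV, Measure.restrict_apply hV]
        gcongr
        refine (measure_mono ?_).trans (box_bound y ρ)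
        rintro x ⟨hx1, hx2⟩
        exact ⟨hKb x hx2, hx1⟩
      · have h1 : ∀ x, F ρ (x, y) = 0 := by
          intro x
          refine indicator_of_notMem (fun hx => hy ?_) _
          have h2 : dist y (P x) < ρ := hx
          rw [dist_eq_norm] at h2
          have h3 := PiLp.norm_apply_le (y - P x) 0
          rw [PiLp.sub_apply, hP0, sub_zero] at h3
          exact h3.trans_lt h2
        simp [h1]
    refine (lintegral_mono hpt).trans ?_
    rw [lintegral_mul_const _ (hf.indicator (hsm ρ)), lintegral_indicator (hsm ρ)]
    gcongr
    exact hslabf ρ hρ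
  set b : ℝ≥0∞ := volume (ball (0 : Euc (n+1)) 1) with hb
  have hb0 : b ≠ 0 := (measure_ball_pos _ _ one_pos).ne'
  have hbt : b ≠ ⊤ := measure_ball_lt_top.ne
  have hball : ∀ ρ > 0, ∀ x : Euc (n+1), volume (ball x ρ) = ENNReal.ofReal (ρ ^ (n+1)) * b := by
    intro ρ hρ x
    rw [Measure.addHaar_ball _ _ hρ.le, hb]; simp
  set M : ℝ≥0∞ := ENNReal.ofReal (4 * A * 2 ^ (n+1)) / b with hM
  have hMt : M ≠ ⊤ := ENNReal.div_ne_top ENNReal.ofReal_ne_top hb0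
  have hfat := lintegral_liminf_le (μ := volume.restrict K) (u := 𝓝[>] (0:ℝ))
    (f := fun ρ x => (∫⁻ y, F ρ (x, y)) / volume (ball (0 : Euc (n+1)) ρ))
    (fun ρ => (hF ρ).lintegral_prod_right'.div_const _)
  have hl : ∀ x, liminf (fun ρ => (∫⁻ y, F ρ (x, y)) / volume (ball (0 : Euc (n+1)) ρ)) (𝓝[>] (0:ℝ))
      = ⊤ := by
    intro x
    refine Tendsto.liminf_eq ?_
    have hx := avg_top hui.aemeasurable (hC (hP0 x)).2
    refine hx.congr' ?_
    filter_upwards [self_mem_nhdsWithin] with ρ hρ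
    rw [hFavg, hball ρ hρ, hball ρ hρ]
  simp only [hl] at hfat
  have hr : liminf (fun ρ => ∫⁻ x in K, (∫⁻ y, F ρ (x, y)) / volume (ball (0 : Euc (n+1)) ρ))
      (𝓝[>] (0:ℝ)) ≤ M := by
    refine (liminf_le_liminf (v := fun _ => M) ?_).trans (liminf_const M).le
    filter_upwards [self_mem_nhdsWithin] with ρ hρ
    have hρ' : (0:ℝ) < ρ := hρ
    simp only [div_eq_mul_inv]
    rw [lintegral_mul_const _ (hF ρ).lintegral_prod_right', ← div_eq_mul_inv, hball ρ hρ]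
    have hr0 : ENNReal.ofReal (ρ ^ (n+1)) ≠ 0 := by
      rw [Ne, ENNReal.ofReal_eq_zero, not_le]; positivity
    refine (ENNReal.div_le_div_right (hupper ρ hρ) _).trans (le_of_eq ?_)
    rw [hM, ← ENNReal.ofReal_pow (by positivity), ← ENNReal.ofReal_mul (by norm_num),
      ← ENNReal.ofReal_mul (by positivity)]
    have : 4 * ρ * A * (2 * (2 * ρ) ^ n) = ρ ^ (n+1) * (4 * A * 2 ^ (n+1)) := by ring
    rw [this, ENNReal.ofReal_mul (by positivity), ENNReal.mul_div_mul_left _ _ hr0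
      ENNReal.ofReal_ne_top]
  have := hfat.trans hr
  rw [lintegral_const, Measure.restrict_apply_univ, ENNReal.top_mul hb0, top_le_iff] at this
  exact hMt this

lemma hausdorff_pos {n : ℕ} :
    0 < (μH[(n : ℝ)] : Measure (Euc (n+1))) {x : Euc (n+1) | x 0 = 0} := by
  let g : Euc (n+1) → (Fin n → ℝ) := fun x i => x i.succ
  have hg : LipschitzWith 1 g := by
    refine LipschitzWith.of_dist_le_mul fun x y => ?_
    rw [NNReal.coe_one, one_mul, dist_pi_le_iff dist_nonneg]
    intro i
    rw [dist_eq_norm, dist_eq_norm]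
    simpa using PiLp.norm_apply_le (x - y) i.succ
  have h1 := hg.hausdorffMeasure_image_le (d := (n : ℝ)) (Nat.cast_nonneg n)
    {x : Euc (n+1) | x 0 = 0}
  have h2 : g '' {x : Euc (n+1) | x 0 = 0} = Set.univ := by
    refine eq_univ_of_forall fun z => ?_
    refine ⟨WithLp.toLp 2 (Fin.cons 0 z), ?_, ?_⟩
    · change (Fin.cons 0 z : Fin (n+1) → ℝ) 0 = 0
      simp
    · ext i
      change (Fin.cons 0 z : Fin (n+1) → ℝ) i.succ = z i
      simp
  have h3 : (μH[(n : ℝ)] : Measure (Fin n → ℝ)) = volume := by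
    have := hausdorffMeasure_pi_real (ι := Fin n)
    simpa using this
  rw [h2, h3] at h1
  simp only [ENNReal.coe_one, ENNReal.one_rpow, one_mul] at h1
  refine lt_of_lt_of_le ?_ h1
  exact isOpen_univ.measure_pos _ univ_nonempty

lemma hyper_null {n : ℕ} : volume {x : Euc (n+1) | x 0 = 0} = 0 := by
  let L : Euc (n+1) →L[ℝ] ℝ := EuclideanSpace.proj 0
  have h := Measure.addHaar_submodule (volume : Measure (Euc (n+1))) (LinearMap.ker L.toLinearMap) (by
    intro h
    have h1 : (EuclideanSpace.single 0 1 : Euc (n+1)) ∈ LinearMap.ker L.toLinearMap := by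
      rw [h]; trivial
    rw [LinearMap.mem_ker] at h1
    simp [L] at h1)
  have h2 : {x : Euc (n+1) | x 0 = 0} = (LinearMap.ker L.toLinearMap : Set (Euc (n+1))) := by
    ext x; rfl
  rw [h2]; exact h

lemma approx_top {n : ℕ} (x : Euc (n+1)) (hx : x 0 = 0) :
    HasInfApproxLimit (fun y : Euc (n+1) => |y 0|⁻¹) Set.univ x := by
  have key : ∀ s : ℝ, ∀ᶠ ρ in 𝓝[>] (0:ℝ), ∀ y ∈ ball x ρ, y 0 ≠ 0 → s < |y 0|⁻¹ := by
    intro s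
    have hpos : 0 < (|s| + 1)⁻¹ := by positivity
    filter_upwards [Ioo_mem_nhdsGT hpos] with ρ hρ y hy hy0
    have h1 : |y 0| < (|s| + 1)⁻¹ := by
      have h2 := PiLp.norm_apply_le (y - x) 0
      rw [PiLp.sub_apply, hx, sub_zero, ← dist_eq_norm] at h2
      exact (h2.trans_lt hy).trans hρ.2
    have h3 : |s| + 1 < |y 0|⁻¹ := by
      rwa [lt_inv_comm₀ (by positivity) (abs_pos.2 hy0)]
    linarith [le_abs_self s]
  left
  constructor
  · unfold approxUpper
    refine sInf_eq_top.2 fun t ht => ?_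
    exfalso
    revert t
    rintro _ ⟨s, -, hs⟩
    unfold HasDensity at hs
    rw [ENNReal.ofReal_zero] at hs
    have h1 : Tendsto (fun ρ : ℝ => volume ({y : Euc (n+1) | y ∈ Set.univ ∧ s < |y 0|⁻¹} ∩ ball x ρ) /
        volume (ball x ρ)) (𝓝[>] 0) (𝓝 1) := by
      refine tendsto_const_nhds.congr' ?_
      filter_upwards [key s, self_mem_nhdsWithin] with ρ hρ hρ0
      have h2 : volume ({y : Euc (n+1) | y ∈ Set.univ ∧ s < |y 0|⁻¹} ∩ ball x ρ) =
          volume (ball x ρ) := by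
        refine le_antisymm (measure_mono inter_subset_right) ?_
        calc volume (ball x ρ) ≤ volume (({y : Euc (n+1) | y ∈ Set.univ ∧ s < |y 0|⁻¹} ∩ ball x ρ) ∪
              {y : Euc (n+1) | y 0 = 0}) := by
              refine measure_mono fun y hy => ?_
              by_cases h0 : y 0 = 0
              · exact Or.inr h0
              · exact Or.inl ⟨⟨mem_univ _, hρ y hy h0⟩, hy⟩
          _ ≤ _ := (measure_union_le _ _).trans (by rw [hyper_null, add_zero])
      rw [h2, ENNReal.div_self (measure_ball_pos _ _ hρ0).ne' measure_ball_lt_top.ne]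
    exact zero_ne_one (tendsto_nhds_unique hs h1)
  · unfold approxLower
    rw [sSup_eq_top]
    intro b hb
    obtain ⟨s, hs, -⟩ := EReal.lt_iff_exists_real_btwn.1 hb
    refine ⟨(s : EReal), ⟨s, rfl, ?_⟩, hs⟩
    unfold HasDensity
    rw [ENNReal.ofReal_zero]
    refine tendsto_const_nhds.congr' ?_
    filter_upwards [key s] with ρ hρ
    have : volume ({y : Euc (n+1) | y ∈ Set.univ ∧ |y 0|⁻¹ < s} ∩ ball x ρ) = 0 := by
      refine measure_mono_null ?_ hyper_null
      rintro y ⟨⟨-, h1⟩, h2⟩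
      by_contra h0
      exact lt_asymm h1 (hρ y h2 h0)
    rw [this, ENNReal.zero_div]

lemma lip_aux {n : ℕ} (m : ℝ) (hm : 0 < m) :
    LipschitzWith (Real.toNNReal (m ^ 2)) (fun x : Euc (n+1) => (max |x 0| m⁻¹)⁻¹) := by
  refine LipschitzWith.of_dist_le_mul fun x y => ?_
  rw [Real.coe_toNNReal _ (by positivity), Real.dist_eq]
  have hi : 0 < m⁻¹ := by positivity
  set a := max |x 0| m⁻¹ with ha
  set b := max |y 0| m⁻¹ with hb
  have ha1 : m⁻¹ ≤ a := le_max_right _ _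
  have hb1 : m⁻¹ ≤ b := le_max_right _ _
  have ha0 : 0 < a := hi.trans_le ha1
  have hb0 : 0 < b := hi.trans_le hb1
  have ha2 : a⁻¹ ≤ m := by rwa [inv_le_comm₀ ha0 hm]
  have hb2 : b⁻¹ ≤ m := by rwa [inv_le_comm₀ hb0 hm]
  have hab : |b - a| ≤ dist x y := by
    calc |b - a| ≤ |(|y 0| - |x 0|)| := abs_max_sub_max_le_abs _ _ _
      _ ≤ |y 0 - x 0| := abs_abs_sub_abs_le _ _
      _ ≤ dist x y := by
        rw [dist_comm, dist_eq_norm]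
        simpa using PiLp.norm_apply_le (y - x) 0
  have : a⁻¹ - b⁻¹ = a⁻¹ * b⁻¹ * (b - a) := by field_simp
  rw [this, abs_mul, abs_of_pos (by positivity)]
  calc a⁻¹ * b⁻¹ * |b - a| ≤ m * m * dist x y := by gcongr
    _ = _ := by ring

lemma lip_variation {w : Euc N → ℝ} {L : NNReal} (hw : LipschitzWith L w) {Ω : Set (Euc N)}
    (hfin : volume Ω < ⊤) : variation w Ω < ⊤ := by
  have : variation w Ω ≤ ENNReal.ofReal (N * (L * volume.real Ω)) := by
    refine iSup₂_le fun φ hφ => ENNReal.ofReal_le_ofReal ?_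
    obtain ⟨hφs, hφc, hφΩ, hφ1⟩ := hφ
    have hφd : Differentiable ℝ φ := hφs.differentiable (by norm_num)
    have hcomp : ∀ i, ContDiff ℝ 1 (fun x => φ x i) := fun i => by fun_prop
    have hcc : ∀ i, HasCompactSupport (fun x => φ x i) := fun i => by
      refine hφc.mono fun x hx h0 => hx ?_
      simp [h0]
    have hfd : ∀ i x v, fderiv ℝ φ x v i = fderiv ℝ (fun x => φ x i) x v := by
      intro i x v
      have h1 : HasFDerivAt (fun x => φ x i)
          ((EuclideanSpace.proj i : Euc N →L[ℝ] ℝ).comp (fderiv ℝ φ x)) x :=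
        (EuclideanSpace.proj i : Euc N →L[ℝ] ℝ).hasFDerivAt.comp x (hφd x).hasFDerivAt
      rw [h1.fderiv]; rfl
    have hfc : ∀ i, Continuous (fun x => fderiv ℝ (fun x => φ x i) x (EuclideanSpace.single i 1)) :=
      fun i => ((hcomp i).continuous_fderiv (by norm_num)).clm_apply continuous_const
    have hfcc : ∀ i, HasCompactSupport
        (fun x => fderiv ℝ (fun x => φ x i) x (EuclideanSpace.single i 1)) :=
      fun i => (hcc i).fderiv_apply (𝕜 := ℝ) _
    have hz : ∀ x, x ∉ Ω → diverg φ x = 0 := by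
      intro x hx
      have h1 : x ∉ tsupport (fderiv ℝ φ) := fun h => hx (hφΩ (tsupport_fderiv_subset ℝ h))
      unfold diverg
      rw [image_eq_zero_of_notMem_tsupport h1]; simp
    have hint : ∀ i, Integrable
        (fun x => w x * fderiv ℝ (fun x => φ x i) x (EuclideanSpace.single i 1)) := fun i =>
      (hw.continuous.mul (hfc i)).integrable_of_hasCompactSupport (hfcc i).mul_left
    have h1 : ∫ x in Ω, w x * diverg φ x = ∫ x, w x * diverg φ x :=
      setIntegral_eq_integral_of_forall_compl_eq_zero fun x hx => by rw [hz x hx, mul_zero]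
    have h2 : ∫ x, w x * diverg φ x = ∑ i, ∫ x, w x *
        fderiv ℝ (fun x => φ x i) x (EuclideanSpace.single i 1) := by
      rw [← integral_finsetSum _ fun i _ => hint i]
      congr 1; ext x
      unfold diverg
      simp only [hfd, Finset.mul_sum]
    rw [h1, h2]
    calc _ ≤ ∑ _i : Fin N, (L * volume.real Ω : ℝ) := Finset.sum_le_sum fun i _ => ?_
      _ = N * (L * volume.real Ω) := by simp
    obtain ⟨D, hD⟩ := (hcomp i).lipschitzWith_of_hasCompactSupport (hcc i) (by norm_num)
    have h3 := hw.integral_lineDeriv_mul_eq (μ := volume) hD (hcc i) (-EuclideanSpace.single i 1)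
    have h4 : ∫ x, w x * fderiv ℝ (fun x => φ x i) x (EuclideanSpace.single i 1) =
        ∫ x, lineDeriv ℝ w x (-EuclideanSpace.single i 1) * φ x i := by
      rw [h3]
      congr 1; ext x
      rw [neg_neg, ((hcomp i).differentiable (by norm_num) x).lineDeriv_eq_fderiv, mul_comm]
    rw [h4]
    have hz2 : ∀ x, x ∉ Ω → φ x = 0 := fun x hx =>
      image_eq_zero_of_notMem_tsupport fun h => hx (hφΩ h)
    rw [← setIntegral_eq_integral_of_forall_compl_eq_zero (s := Ω)
      fun x hx => by simp [hz2 x hx]]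
    refine (le_abs_self _).trans ?_
    rw [← Real.norm_eq_abs]
    refine norm_setIntegral_le_of_norm_le_const hfin fun x _ => ?_
    rw [norm_mul]
    have h5 : ‖lineDeriv ℝ w x (-EuclideanSpace.single i 1)‖ ≤ L := by
      have := norm_lineDeriv_le_of_lipschitz (𝕜 := ℝ) (x₀ := x)
        (v := (-EuclideanSpace.single i 1 : Euc N)) hw
      simpa using this
    have h6 : ‖φ x i‖ ≤ 1 := (PiLp.norm_apply_le _ i).trans (hφ1 x)
    calc _ ≤ (L : ℝ) * 1 := by gcongr
      _ = L := mul_one _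
  exact this.trans_lt ENNReal.ofReal_lt_top

lemma gbvpolar {n : ℕ} : GBVPolar {x : Euc (n+1) | x 0 = 0} Set.univ := by
  refine ⟨fun y => |y 0|⁻¹, ⟨?_, ?_⟩, fun x hx => ⟨mem_univ _, approx_top x hx⟩⟩
  · have : Measurable (fun y : Euc (n+1) => |y 0|⁻¹) := by
      have : Measurable (fun y : Euc (n+1) => |y 0|) :=
        (show Continuous (fun y : Euc (n+1) => |y 0|) by fun_prop).measurable
      exact this.inv
    exact this.aemeasurable
  · intro m hm Ω' ho hc _
    have hfin : volume Ω' < ⊤ := (measure_mono subset_closure).trans_lt hc.measure_lt_top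
    have hlip := lip_aux (n := n) m hm
    have hae : (fun x : Euc (n+1) => max (-m) (min |x 0|⁻¹ m)) =ᵐ[volume]
        fun x => (max |x 0| m⁻¹)⁻¹ := by
      have h0 : ∀ᵐ x : Euc (n+1), x 0 ≠ 0 := by
        rw [ae_iff]; simpa using hyper_null (n := n)
      filter_upwards [h0] with x hx
      have hx' : 0 < |x 0| := abs_pos.2 hx
      have h1 : 0 ≤ min |x 0|⁻¹ m := le_min (by positivity) hm.le
      rw [max_eq_right (by linarith)]
      rcases le_total |x 0| m⁻¹ with h | h
      · rw [max_eq_right h, inv_inv, min_eq_right]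
        rwa [le_inv_comm₀ hm hx']
      · rw [max_eq_left h, min_eq_left]
        rwa [inv_le_comm₀ hx' hm]
    constructor
    · refine IntegrableOn.congr_fun_ae ?_ (ae_restrict_of_ae hae.symm)
      exact (hlip.continuous.continuousOn.integrableOn_compact hc).mono_set subset_closure
    · have : variation (fun x : Euc (n+1) => max (-m) (min |x 0|⁻¹ m)) Ω' =
          variation (fun x => (max |x 0| m⁻¹)⁻¹) Ω' := by
        unfold variation
        refine iSup_congr fun φ => iSup_congr fun _ => ?_
        congr 1
        refine integral_congr_ae (ae_restrict_of_ae ?_)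
        filter_upwards [hae] with x hx
        rw [hx]
      rw [this]
      exact lip_variation hlip hfin

/-- for every `N ≥ 2` there is a set `C ⊆ ℝ^N` which is `GBV`-polar in
`ℝ^N` but has `H^{N-1}(C) > 0`; consequently `C` is `GBV`-polar but not `BV`-polar. -/
theorem statement19 (N : ℕ) (hN : 2 ≤ N) :
    ∃ C : Set (Euc N), GBVPolar C Set.univ ∧
      0 < (μH[(N : ℝ) - 1] : Measure (Euc N)) C ∧ ¬ BVPolar C Set.univ := by
  obtain ⟨n, rfl⟩ : ∃ n, N = n + 1 := ⟨N - 1, by omega⟩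
  refine ⟨{x : Euc (n+1) | x 0 = 0}, gbvpolar, ?_, not_bvpolar⟩
  have h : ((n + 1 : ℕ) : ℝ) - 1 = n := by push_cast; ring
  rw [h]
  exact hausdorff_pos
end
end
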